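/- arXiv:2507.17878 — 5 statements merged into one kernel-verified Lean document; each statement's English description precedes it below -/
import Mathlib

section
/- For every natural number d, if v_1, …, v_{2^d} is a bijective enumeration of all of 𝔽₂^d and N_1, …, N_{2^d} ⊆ 𝔽₂^d are finite sets satisfying condition (i) (for all i, v_i + N_i = N_i) and condition (ii) (for all i and all j < i, v_j ∉ span_{𝔽₂}(N_i + N_i)), then Σ_{i=1}^{2^d} |N_i| ≤ 2 · 3^d. -/
open Pointwise

/-- The square-free monomial `∏ k ∈ S, x k`, as a function on `𝔽₂^d`. -/
def squarefreeMonomial {d : ℕ} (S : Finset (Fin d)) : (Fin d → ZMod 2) → ZMod 2 :=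
  fun x => ∏ k ∈ S, x k

/-- The space of functions on `𝔽₂^d` given by polynomials of degree at most `c`. -/
def polyFun (d c : ℕ) : Submodule (ZMod 2) ((Fin d → ZMod 2) → ZMod 2) :=
  Submodule.span (ZMod 2)
    ((Finset.univ.filter fun S : Finset (Fin d) => S.card ≤ c).image squarefreeMonomial :
      Finset ((Fin d → ZMod 2) → ZMod 2))

lemma squarefreeMonomial_mem_polyFun {d c : ℕ} {S : Finset (Fin d)} (hS : S.card ≤ c) :
    squarefreeMonomial S ∈ polyFun d c :=
  Submodule.subset_span <| Finset.mem_coe.2 <|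
    Finset.mem_image_of_mem _ (Finset.mem_filter.2 ⟨Finset.mem_univ _, hS⟩)

lemma polyFun_mono (d : ℕ) : Monotone (polyFun d) := by
  intro c c' h
  refine Submodule.span_mono ?_
  refine Finset.coe_subset.2 (Finset.image_subset_image fun S hS => ?_)
  simp only [Finset.mem_filter, Finset.mem_univ, true_and] at hS ⊢
  exact hS.trans h

lemma one_mem_polyFun (d c : ℕ) : (1 : (Fin d → ZMod 2) → ZMod 2) ∈ polyFun d c := by
  have h : squarefreeMonomial (∅ : Finset (Fin d)) = 1 := by
    ext x
    simp [squarefreeMonomial]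
  exact h ▸ squarefreeMonomial_mem_polyFun (by simp)

lemma finrank_polyFun_le (d c : ℕ) :
    Module.finrank (ZMod 2) (polyFun d c) ≤
      (Finset.univ.filter fun S : Finset (Fin d) => S.card ≤ c).card :=
  (finrank_span_finset_le_card _).trans Finset.card_image_le

lemma squarefreeMonomial_mul_coord {d : ℕ} (S : Finset (Fin d)) (k : Fin d) :
    (squarefreeMonomial S * fun x => x k) = squarefreeMonomial (insert k S) := by
  have idem : ∀ a : ZMod 2, a * a = a := by decide
  ext x
  by_cases hk : k ∈ S
  · simp only [squarefreeMonomial, Pi.mul_apply, Finset.insert_eq_self.2 hk]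
    rw [← Finset.mul_prod_erase S _ hk, mul_right_comm, idem]
  · simp [squarefreeMonomial, Finset.prod_insert hk, mul_comm]

lemma mul_coord_mem_polyFun {d c : ℕ} {f : (Fin d → ZMod 2) → ZMod 2} (hf : f ∈ polyFun d c)
    (k : Fin d) : (f * fun x => x k) ∈ polyFun d (c + 1) := by
  induction hf using Submodule.span_induction with
  | mem g hg =>
    obtain ⟨S, hS, rfl⟩ := Finset.mem_image.1 (Finset.mem_coe.1 hg)
    rw [squarefreeMonomial_mul_coord]
    exact squarefreeMonomial_mem_polyFun
      ((Finset.card_insert_le _ _).trans (Nat.succ_le_succ (Finset.mem_filter.1 hS).2))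
  | zero => simp
  | add g h _ _ hg hh => rw [add_mul]; exact add_mem hg hh
  | smul a g _ hg => rw [smul_mul_assoc]; exact Submodule.smul_mem _ _ hg

lemma mul_one_sub_dual_mem_polyFun {d c : ℕ} {f : (Fin d → ZMod 2) → ZMod 2}
    (hf : f ∈ polyFun d c) (l : (Fin d → ZMod 2) →ₗ[ZMod 2] ZMod 2) :
    (f * fun x => 1 - l x) ∈ polyFun d (c + 1) := by
  have h : (f * fun x => 1 - l x) =
      f - ∑ k, l (Pi.single k 1) • (f * fun x => x k) := by
    ext x
    have hl := LinearMap.pi_apply_eq_sum_univ l x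
    simp only [Pi.mul_apply, Pi.sub_apply, Finset.sum_apply, Pi.smul_apply, smul_eq_mul] at hl ⊢
    rw [hl, mul_sub, mul_one, Finset.mul_sum]
    congr 1
    refine Finset.sum_congr rfl fun k _ => ?_
    rw [mul_comm (x k), mul_left_comm]
    congr 2
    ext j
    simp [Pi.single_apply, eq_comm]
  rw [h]
  exact sub_mem (polyFun_mono d (Nat.le_succ c) hf)
    (sum_mem fun k _ => Submodule.smul_mem _ _ (mul_coord_mem_polyFun hf k))

lemma prod_one_sub_dual_mem_polyFun {d : ℕ} {ι : Type*} (s : Finset ι)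
    (l : ι → (Fin d → ZMod 2) →ₗ[ZMod 2] ZMod 2) :
    (fun x => ∏ k ∈ s, (1 - l k x)) ∈ polyFun d s.card := by
  classical
  induction s using Finset.induction_on with
  | empty =>
    simp only [Finset.prod_empty]
    exact one_mem_polyFun d _
  | insert a s ha ih =>
    have h := mul_one_sub_dual_mem_polyFun ih (l a)
    rw [Finset.card_insert_of_notMem ha]
    convert h using 1
    ext x
    simp [Finset.prod_insert ha, mul_comm]

/-- The indicator function of a subspace of codimension `c` has degree at most `c`. -/
lemma exists_polyFun_ne_zero_iff_mem {d : ℕ} (W : Submodule (ZMod 2) (Fin d → ZMod 2)) :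
    ∃ f ∈ polyFun d (Module.finrank (ZMod 2) ((Fin d → ZMod 2) ⧸ W)),
      ∀ x, f x ≠ 0 ↔ x ∈ W := by
  let b := Module.finBasis (ZMod 2) ((Fin d → ZMod 2) ⧸ W)
  have hz : ∀ a : ZMod 2, 1 - a ≠ 0 ↔ a = 0 := by decide
  have hmem := prod_one_sub_dual_mem_polyFun Finset.univ fun k => b.coord k ∘ₗ W.mkQ
  rw [Finset.card_univ, Fintype.card_fin] at hmem
  refine ⟨_, hmem, fun x => ?_⟩
  simp only [Finset.prod_ne_zero_iff, Finset.mem_univ, true_imp_iff, hz, LinearMap.comp_apply]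
  rw [b.forall_coord_eq_zero_iff, Submodule.mkQ_apply, Submodule.Quotient.mk_eq_zero]

lemma linearIndependent_of_triangular {K ι α : Type*} [Field K] [LinearOrder ι] [Finite ι]
    (p : ι → α → K) (v : ι → α) (hd : ∀ i, p i (v i) ≠ 0)
    (ht : ∀ i j, j < i → p i (v j) = 0) : LinearIndependent K p := by
  have := Fintype.ofFinite ι
  rw [Fintype.linearIndependent_iff]
  intro g hg i
  induction i using WellFoundedLT.induction with
  | ind m ih =>
    have h := congrFun hg (v m)
    simp only [Finset.sum_apply, Pi.smul_apply, smul_eq_mul, Pi.zero_apply] at h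
    rw [Finset.sum_eq_single m] at h
    · exact (mul_eq_zero.1 h).resolve_right (hd m)
    · intro j _ hj
      rcases lt_or_gt_of_ne hj with hj | hj
      · rw [ih j hj, zero_mul]
      · rw [ht j m hj, mul_zero]
    · simp

/-- At most `∑ j ≤ c, d.choose j` of the subspaces in a triangular system have codimension at
most `c`. -/
lemma card_le_of_triangular_subspaces {d : ℕ} {ι : Type*} [LinearOrder ι] (s : Finset ι)
    (v : ι → Fin d → ZMod 2) (W : ι → Submodule (ZMod 2) (Fin d → ZMod 2)) (c : ℕ)
    (hc : ∀ i ∈ s, Module.finrank (ZMod 2) ((Fin d → ZMod 2) ⧸ W i) ≤ c)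
    (hd : ∀ i ∈ s, v i ∈ W i) (ht : ∀ i ∈ s, ∀ j ∈ s, j < i → v j ∉ W i) :
    s.card ≤ (Finset.univ.filter fun S : Finset (Fin d) => S.card ≤ c).card := by
  choose p hp hpW using fun i => exists_polyFun_ne_zero_iff_mem (W i)
  have hli : LinearIndependent (ZMod 2) fun i : s => p i :=
    linearIndependent_of_triangular _ (fun i : s => v i) (fun i => (hpW _ _).2 (hd i i.2))
      fun i j hj => not_not.1 fun h => ht i i.2 j j.2 hj ((hpW _ _).1 h)
  have hle : Submodule.span (ZMod 2) (Set.range fun i : s => p i) ≤ polyFun d c := by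
    rw [Submodule.span_le]
    rintro _ ⟨i, rfl⟩
    exact polyFun_mono d (hc i i.2) (hp i)
  calc s.card = Module.finrank (ZMod 2) (Submodule.span (ZMod 2) (Set.range fun i : s => p i)) := by
        rw [finrank_span_eq_card hli, Fintype.card_coe]
    _ ≤ Module.finrank (ZMod 2) (polyFun d c) := Submodule.finrank_mono hle
    _ ≤ _ := finrank_polyFun_le d c

lemma card_le_two_pow_of_add_mem {d : ℕ} (A : Finset (Fin d → ZMod 2))
    (W : Submodule (ZMod 2) (Fin d → ZMod 2)) (hA : ∀ a ∈ A, ∀ b ∈ A, a + b ∈ W) :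
    A.card ≤ 2 ^ (d - Module.finrank (ZMod 2) ((Fin d → ZMod 2) ⧸ W)) := by
  rcases A.eq_empty_or_nonempty with rfl | ⟨w, hw⟩
  · simp
  have hW : d - Module.finrank (ZMod 2) ((Fin d → ZMod 2) ⧸ W) = Module.finrank (ZMod 2) W := by
    have := W.finrank_quotient_add_finrank
    rw [Module.finrank_fin_fun] at this
    omega
  have hcard : Nat.card W = 2 ^ Module.finrank (ZMod 2) W := by
    rw [Module.natCard_eq_pow_finrank (K := ZMod 2), Nat.card_zmod]
  rw [hW, ← hcard, ← Nat.card_eq_finsetCard]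
  exact Nat.card_le_card_of_injective (fun a : A => (⟨a + w, hA a a.2 w hw⟩ : W))
    fun a b hab => Subtype.ext (add_right_cancel (Subtype.ext_iff.1 hab))

lemma sum_two_pow_filter_le (d m : ℕ) :
    ∑ c ∈ (Finset.range (d + 1)).filter (m ≤ ·), 2 ^ (d - c) ≤ 2 * 2 ^ (d - m) := by
  calc _ ≤ ∑ e ∈ Finset.range (d - m + 1), 2 ^ e := by
        rw [← Finset.sum_image (f := fun e => 2 ^ e) (g := fun c => d - c)]
        · refine Finset.sum_le_sum_of_subset fun e he => ?_
          simp only [Finset.mem_image, Finset.mem_filter, Finset.mem_range] at he ⊢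
          omega
        · intro a ha b hb hab
          simp only [Finset.coe_filter, Finset.mem_range, Set.mem_ofPred_eq] at ha hb hab
          omega
    _ ≤ 2 * 2 ^ (d - m) := by
        rw [← pow_succ']
        exact (Nat.geomSum_lt le_rfl fun e he => Finset.mem_range.1 he).le

/-- If `v` enumerates all of `𝔽₂^d` bijectively and the sets `N i ⊆ 𝔽₂^d`
satisfy (i) `v i + N i = N i` and (ii) `v j ∉ span (N i + N i)` for `j < i`, then
`∑ i, |N i| ≤ 2 * 3 ^ d`. -/
theorem statement1 (d : ℕ) (v : Fin (2 ^ d) → (Fin d → ZMod 2))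
    (hv : Function.Bijective v)
    (N : Fin (2 ^ d) → Finset (Fin d → ZMod 2))
    (h1 : ∀ i, (N i).image (fun w => v i + w) = N i)
    (h2 : ∀ i j : Fin (2 ^ d), j < i →
      v j ∉ Submodule.span (ZMod 2)
        (((N i + N i : Finset (Fin d → ZMod 2))) : Set (Fin d → ZMod 2))) :
    ∑ i, (N i).card ≤ 2 * 3 ^ d := by
  set W : Fin (2 ^ d) → Submodule (ZMod 2) (Fin d → ZMod 2) := fun i =>
    Submodule.span (ZMod 2) ((N i + N i : Finset (Fin d → ZMod 2)) : Set (Fin d → ZMod 2))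
  set codim : Fin (2 ^ d) → ℕ := fun i => Module.finrank (ZMod 2) ((Fin d → ZMod 2) ⧸ W i)
  have hadd : ∀ i, ∀ a ∈ N i, ∀ b ∈ N i, a + b ∈ W i := fun i a ha b hb =>
    Submodule.subset_span (Finset.mem_coe.2 (Finset.add_mem_add ha hb))
  have hmem : ∀ i, (N i).Nonempty → v i ∈ W i := by
    rintro i ⟨w, hw⟩
    have hvw : v i + w ∈ N i := by
      have := Finset.mem_image_of_mem (fun w => v i + w) hw
      rwa [h1 i] at this
    have h := hadd i _ hvw w hw
    have hww : w + w = 0 := funext fun k => CharTwo.add_self_eq_zero (w k)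
    rwa [add_assoc, hww, add_zero] at h
  have hcodim : ∀ i, codim i ≤ d := fun i => by
    have := (W i).finrank_quotient_le
    rwa [Module.finrank_fin_fun] at this
  set G := Finset.univ.filter fun i => (N i).Nonempty
  have hG : ∀ c, (G.filter (codim · ≤ c)).card ≤
      (Finset.univ.filter fun S : Finset (Fin d) => S.card ≤ c).card := fun c =>
    card_le_of_triangular_subspaces _ v W c (fun i hi => (Finset.mem_filter.1 hi).2)
      (fun i hi => hmem i (Finset.mem_filter.1 (Finset.mem_filter.1 hi).1).2)
      fun i _ j _ hj => h2 i j hj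
  calc ∑ i, (N i).card = ∑ i ∈ G, (N i).card := by
        refine (Finset.sum_subset (Finset.subset_univ _) fun i _ hi => ?_).symm
        simpa [G] using hi
    _ ≤ ∑ i ∈ G, ∑ c ∈ (Finset.range (d + 1)).filter (codim i ≤ ·), 2 ^ (d - c) :=
        Finset.sum_le_sum fun i _ => (card_le_two_pow_of_add_mem _ _ (hadd i)).trans
          (Finset.single_le_sum (f := fun c => 2 ^ (d - c)) (fun _ _ => Nat.zero_le _)
            (Finset.mem_filter.2 ⟨Finset.mem_range.2 (Nat.lt_succ_of_le (hcodim i)), le_rfl⟩))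
    _ = ∑ c ∈ Finset.range (d + 1), (G.filter (codim · ≤ c)).card * 2 ^ (d - c) := by
        simp only [Finset.sum_filter]
        rw [Finset.sum_comm]
        simp only [← Finset.sum_filter, Finset.sum_const, smul_eq_mul]
    _ ≤ ∑ c ∈ Finset.range (d + 1),
          (Finset.univ.filter fun S : Finset (Fin d) => S.card ≤ c).card * 2 ^ (d - c) :=
        Finset.sum_le_sum fun c _ => Nat.mul_le_mul_right _ (hG c)
    _ = ∑ S : Finset (Fin d),
          ∑ c ∈ (Finset.range (d + 1)).filter (S.card ≤ ·), 2 ^ (d - c) := by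
        simp only [Finset.sum_filter]
        rw [Finset.sum_comm]
        simp only [← Finset.sum_filter, Finset.sum_const, smul_eq_mul]
    _ ≤ ∑ S : Finset (Fin d), 2 * 2 ^ (d - S.card) :=
        Finset.sum_le_sum fun S _ => sum_two_pow_filter_le d S.card
    _ = 2 * 3 ^ d := by
        have h := Fin.sum_pow_mul_eq_add_pow (n := d) 1 2
        simp only [one_pow, one_mul] at h
        rw [← Finset.mul_sum, h]
end

section
/- For every natural number d there exist a bijective enumeration v_1, …, v_{2^d} of 𝔽₂^d and finite sets N_1, …, N_{2^d} ⊆ 𝔽₂^d satisfying condition (i) (for all i, v_i + N_i = N_i) and condition (ii) (for all i and all j < i, v_j ∉ span_{𝔽₂}(N_i + N_i)) such that Σ_{i=1}^{2^d} |N_i| = 3^d. Concretely, identifying vectors in 𝔽₂^d with subsets of {1, …, d} via supports, order the vectors by decreasing cardinality of support and take N_S = {T : supp(T) ⊆ supp(S)}. -/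
open Pointwise

/-- The finite set of vectors over `𝔽₂` supported inside the support of `x`. -/
def supportedWithin {ι : Type*} [Fintype ι] [DecidableEq ι] (x : ι → ZMod 2) :
    Finset (ι → ZMod 2) :=
  Fintype.piFinset fun k => if x k = 0 then {0} else Finset.univ

section supportedWithin

variable {ι : Type*} [Fintype ι] [DecidableEq ι] {x w y : ι → ZMod 2}

theorem mem_supportedWithin : w ∈ supportedWithin x ↔ ∀ k, x k = 0 → w k = 0 := by
  simp only [supportedWithin, Fintype.mem_piFinset]
  refine forall_congr' fun k => ?_
  split_ifs with h <;> simp [h]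

theorem add_mem_supportedWithin (hw : w ∈ supportedWithin x) (hy : y ∈ supportedWithin x) :
    w + y ∈ supportedWithin x := by
  rw [mem_supportedWithin] at *
  intro k hk
  simp [hw k hk, hy k hk]

theorem self_mem_supportedWithin : x ∈ supportedWithin x :=
  mem_supportedWithin.2 fun _ h => h

theorem image_add_supportedWithin (x : ι → ZMod 2) :
    (supportedWithin x).image (fun w => x + w) = supportedWithin x := by
  refine Finset.eq_of_subset_of_card_le (Finset.image_subset_iff.2 fun w hw =>
    add_mem_supportedWithin self_mem_supportedWithin hw) ?_
  rw [Finset.card_image_of_injective _ (add_right_injective x)]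

theorem mem_supportedWithin_of_mem_span
    (h : w ∈ Submodule.span (ZMod 2)
      ((supportedWithin x + supportedWithin x : Finset (ι → ZMod 2)) : Set (ι → ZMod 2))) :
    w ∈ supportedWithin x := by
  rw [mem_supportedWithin]
  intro k hk
  have hle : Submodule.span (ZMod 2)
      ((supportedWithin x + supportedWithin x : Finset (ι → ZMod 2)) : Set (ι → ZMod 2)) ≤
      LinearMap.ker (LinearMap.proj k : (ι → ZMod 2) →ₗ[ZMod 2] ZMod 2) := by
    refine Submodule.span_le.2 fun z hz => ?_
    obtain ⟨a, ha, b, hb, rfl⟩ := Finset.mem_add.1 (Finset.mem_coe.1 hz)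
    exact mem_supportedWithin.1 (add_mem_supportedWithin ha hb) k hk
  exact hle h

theorem eq_of_mem_supportedWithin (h : w ∈ supportedWithin x)
    (hcard : (Finset.univ.filter fun k => w k = 0).card ≤
      (Finset.univ.filter fun k => x k = 0).card) : w = x := by
  rw [mem_supportedWithin] at h
  have heq := Finset.eq_of_subset_of_card_le
    (Finset.monotone_filter_right Finset.univ fun k _ => h k) hcard
  have hiff (k : ι) : x k = 0 ↔ w k = 0 := by
    simpa using Finset.ext_iff.1 heq k
  have key : ∀ a b : ZMod 2, (a = 0 ↔ b = 0) → b = a := by decide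
  exact funext fun k => key _ _ (hiff k)

theorem sum_card_supportedWithin :
    ∑ x : ι → ZMod 2, (supportedWithin x).card = 3 ^ Fintype.card ι := by
  have hprod := Finset.prod_univ_sum (fun _ : ι => (Finset.univ : Finset (ZMod 2)))
    (fun _ a => (if a = 0 then {0} else Finset.univ : Finset (ZMod 2)).card)
  have hsum : ∑ a : ZMod 2, (if a = 0 then {0} else Finset.univ : Finset (ZMod 2)).card = 3 := by
    decide
  simp only [hsum, Finset.prod_const, Finset.card_univ, Fintype.piFinset_univ] at hprod
  simp only [supportedWithin, Fintype.card_piFinset]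
  exact hprod.symm

end supportedWithin

/-- For every `d` there exist a bijective enumeration `v` of `𝔽₂^d` and sets
`N i ⊆ 𝔽₂^d` satisfying (i) `v i + N i = N i` and (ii) `v j ∉ span (N i + N i)` for `j < i`,
with `∑ i, |N i| = 3 ^ d`. -/
theorem statement2 (d : ℕ) :
    ∃ (v : Fin (2 ^ d) → (Fin d → ZMod 2)) (N : Fin (2 ^ d) → Finset (Fin d → ZMod 2)),
      Function.Bijective v ∧
      (∀ i, (N i).image (fun w => v i + w) = N i) ∧
      (∀ i j : Fin (2 ^ d), j < i →
        v j ∉ Submodule.span (ZMod 2)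
          (((N i + N i : Finset (Fin d → ZMod 2))) : Set (Fin d → ZMod 2))) ∧
      ∑ i, (N i).card = 3 ^ d := by
  let e : Fin (2 ^ d) ≃ (Fin d → ZMod 2) :=
    (Fintype.equivFinOfCardEq (by simp [ZMod.card])).symm
  let zeros : Fin (2 ^ d) → ℕ := fun i => (Finset.univ.filter fun k => e i k = 0).card
  let v : Fin (2 ^ d) ≃ (Fin d → ZMod 2) := (Tuple.sort zeros).trans e
  refine ⟨v, fun i => supportedWithin (v i), v.bijective,
    fun i => image_add_supportedWithin (v i), fun i j hji hmem => hji.ne ?_, ?_⟩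
  · exact v.injective (eq_of_mem_supportedWithin (mem_supportedWithin_of_mem_span hmem)
      (Tuple.monotone_sort zeros hji.le))
  · rw [v.sum_comp fun x => (supportedWithin x).card, sum_card_supportedWithin, Fintype.card_fin]
end

section
/- Let H be an 𝔽₂-linear subspace of 𝔽₂^d. If v_1, …, v_n are distinct vectors in 𝔽₂^d with V = {v_1, …, v_n} ⊆ H, and N_1, …, N_n ⊆ V are finite sets satisfying condition (i) (for all i, v_i + N_i = N_i) and condition (ii) (for all i and all j < i, v_j ∉ span_{𝔽₂}(N_i + N_i)), then Σ_{i=1}^n |N_i| ≤ 2 · 3^{dim H}. -/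
open Pointwise

/-- The squarefree monomial functions of degree at most `k` in the coordinates of a basis span
a space which contains the product of `k` functions of the form `1 + φ`, `φ` linear. -/
theorem prod_one_add_mem_span_monomials {κ M : Type*} [Fintype κ] [DecidableEq κ]
    [AddCommGroup M] [Module (ZMod 2) M] (b : Module.Basis κ (ZMod 2) M)
    {τ : Type*} (s : Finset τ) (φ : τ → M →ₗ[ZMod 2] ZMod 2) :
    (fun x => ∏ k ∈ s, (1 + φ k x)) ∈ Submodule.span (ZMod 2)
      ((fun (S : Finset κ) (x : M) => ∏ j ∈ S, b.repr x j) '' {S | S.card ≤ s.card}) := by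
  classical
  induction s using Finset.induction_on with
  | empty =>
    refine Submodule.subset_span ⟨∅, by simp, ?_⟩
    simp
  | insert t s ht ih =>
    rw [Finset.card_insert_of_notMem ht]
    simp only [Finset.prod_insert ht]
    have hφ : ∀ x, φ t x = ∑ j, φ t (b j) * b.repr x j := fun x => by
      conv_lhs => rw [← b.sum_repr x, map_sum]
      simp only [map_smul, smul_eq_mul, mul_comm]
    have key : (fun x => (1 + φ t x) * ∏ k ∈ s, (1 + φ k x)) =
        (fun x => ∏ k ∈ s, (1 + φ k x)) +
          ∑ j, φ t (b j) • ((fun x => b.repr x j) * fun x => ∏ k ∈ s, (1 + φ k x)) := by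
      funext x
      simp [hφ x, add_mul, Finset.sum_mul, mul_assoc]
    rw [key]
    refine add_mem (Submodule.span_mono (Set.image_mono fun S hS => Nat.le_succ_of_le hS) ih)
      (sum_mem fun j _ => Submodule.smul_mem _ _ ?_)
    refine Submodule.span_induction
      (p := fun f _ => (fun x => b.repr x j) * f ∈ Submodule.span (ZMod 2)
        ((fun (S : Finset κ) (x : M) => ∏ j ∈ S, b.repr x j) '' {S | S.card ≤ s.card + 1}))
      ?_ ?_ ?_ ?_ ih
    · rintro _ ⟨S, hS, rfl⟩
      refine Submodule.subset_span
        ⟨insert j S, (Finset.card_insert_le _ _).trans (Nat.succ_le_succ hS), ?_⟩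
      funext x
      by_cases hj : j ∈ S
      · have h : ∀ a : ZMod 2, a * a = a := by decide
        simp only [Finset.insert_eq_of_mem hj, Pi.mul_apply]
        rw [← Finset.mul_prod_erase S _ hj, ← mul_assoc, h]
      · simp [Finset.prod_insert hj]
    · simp
    · intro f g _ _ hf hg
      rw [mul_add]
      exact add_mem hf hg
    · intro a f _ hf
      rw [mul_smul_comm]
      exact Submodule.smul_mem _ _ hf

/-- The indicator function of a subspace of codimension `r` over `𝔽₂` is a polynomial function of
degree at most `r`. -/
theorem indicator_submodule_mem_span_monomials {κ M : Type*} [Fintype κ] [DecidableEq κ]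
    [AddCommGroup M] [Module (ZMod 2) M] (b : Module.Basis κ (ZMod 2) M)
    (W : Submodule (ZMod 2) M) :
    (W : Set M).indicator (1 : M → ZMod 2) ∈ Submodule.span (ZMod 2)
      ((fun (S : Finset κ) (x : M) => ∏ j ∈ S, b.repr x j) ''
        {S | S.card ≤ Module.finrank (ZMod 2) (M ⧸ W)}) := by
  have : Module.Finite (ZMod 2) M := .of_basis b
  let c := Module.finBasis (ZMod 2) (M ⧸ W)
  have h := prod_one_add_mem_span_monomials b Finset.univ fun k => c.coord k ∘ₗ W.mkQ
  rw [Finset.card_univ, Fintype.card_fin] at h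
  convert h using 1
  funext x
  by_cases hx : x ∈ W
  · simp [hx, (Submodule.Quotient.mk_eq_zero W).2 hx]
  · obtain ⟨k, hk⟩ : ∃ k, c.coord k (W.mkQ x) ≠ 0 := by
      by_contra! hc
      exact hx ((Submodule.Quotient.mk_eq_zero W).1 (c.forall_coord_eq_zero_iff.1 hc))
    rw [Set.indicator_of_notMem (by simpa using hx), eq_comm]
    refine Finset.prod_eq_zero (Finset.mem_univ k) ?_
    have h2 : ∀ a : ZMod 2, a ≠ 0 → 1 + a = 0 := by decide
    exact h2 _ hk

/-- Functions that are unitriangular with respect to evaluation at points are linearly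
independent. -/
theorem linearIndependent_of_triangular_eval {K M ι : Type*} [Field K] [LinearOrder ι]
    [Fintype ι] (f : ι → M → K) (v : ι → M) (hf : ∀ i, f i (v i) = 1)
    (hf0 : ∀ i j, j < i → f i (v j) = 0) : LinearIndependent K f := by
  rw [Fintype.linearIndependent_iff]
  intro g hg i
  induction i using WellFoundedLT.induction with
  | ind i ih =>
    have h := congrFun hg (v i)
    rw [Finset.sum_apply, Finset.sum_eq_single i] at h
    · simpa [hf] using h
    · intro j _ hj
      rcases lt_or_gt_of_ne hj with hj | hj
      · simp [ih j hj]
      · simp [hf0 j i hj]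
    · simp

/-- A skew Bollobás-type inequality for subspaces over `𝔽₂`. -/
theorem sum_two_pow_finrank_le_three_pow {M ι : Type*} [AddCommGroup M] [Module (ZMod 2) M]
    [Module.Finite (ZMod 2) M] [LinearOrder ι] [Fintype ι] (v : ι → M)
    (W : ι → Submodule (ZMod 2) M) (hv : ∀ i, v i ∈ W i) (hvW : ∀ i j, j < i → v j ∉ W i) :
    ∑ i, 2 ^ Module.finrank (ZMod 2) (W i) ≤ 3 ^ Module.finrank (ZMod 2) M := by
  classical
  let b := Module.finBasis (ZMod 2) M
  let f : ι → M → ZMod 2 := fun i => (W i : Set M).indicator 1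
  let mon : Finset (Fin (Module.finrank (ZMod 2) M)) → M → ZMod 2 :=
    fun S x => ∏ j ∈ S, b.repr x j
  have hf : LinearIndependent (ZMod 2) f := linearIndependent_of_triangular_eval f v
    (fun i => by simp [f, hv i]) (fun i j hj => by simp [f, hvW i j hj])
  let t : ι → Finset (Finset (Fin (Module.finrank (ZMod 2) M))) := fun i =>
    {S | S.card ≤ Module.finrank (ZMod 2) (M ⧸ W i)}
  obtain ⟨e, he, het⟩ := (Finset.all_card_le_biUnion_card_iff_exists_injective t).1 fun A => by
    have hA : LinearIndependent (ZMod 2) fun i : A => f i := hf.comp _ Subtype.val_injective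
    have hspan : Submodule.span (ZMod 2) (Set.range fun i : A => f i) ≤
        Submodule.span (ZMod 2) (((A.biUnion t).image mon : Finset _) : Set (M → ZMod 2)) := by
      rw [Submodule.span_le]
      rintro _ ⟨i, rfl⟩
      refine Submodule.span_mono ?_ (indicator_submodule_mem_span_monomials b (W i))
      rw [Finset.coe_image]
      refine Set.image_mono fun S hS => ?_
      exact Finset.mem_biUnion.2 ⟨i, i.2, Finset.mem_filter.2 ⟨Finset.mem_univ _, hS⟩⟩
    have := Module.Finite.span_finset (ZMod 2) ((A.biUnion t).image mon)
    calc A.card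
        = Module.finrank (ZMod 2) (Submodule.span (ZMod 2) (Set.range fun i : A => f i)) := by
          rw [finrank_span_eq_card hA, Fintype.card_coe]
      _ ≤ _ := Submodule.finrank_mono hspan
      _ ≤ _ := finrank_span_finset_le_card _
      _ ≤ _ := Finset.card_image_le
  calc ∑ i, 2 ^ Module.finrank (ZMod 2) (W i)
      ≤ ∑ i, 2 ^ (Module.finrank (ZMod 2) M - (e i).card) := by
        refine Finset.sum_le_sum fun i _ => Nat.pow_le_pow_right two_pos ?_
        have h := (Finset.mem_filter.1 (het i)).2
        have h' := (W i).finrank_quotient_add_finrank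
        omega
    _ = ∑ S ∈ Finset.univ.image e, 2 ^ (Module.finrank (ZMod 2) M - S.card) := by
        rw [Finset.sum_image he.injOn]
    _ ≤ ∑ S : Finset (Fin (Module.finrank (ZMod 2) M)), 2 ^ (Module.finrank (ZMod 2) M - S.card) :=
        Finset.sum_le_sum_of_subset (Finset.subset_univ _)
    _ = 3 ^ Module.finrank (ZMod 2) M := by
        have h := Fintype.sum_pow_mul_eq_add_pow (Fin (Module.finrank (ZMod 2) M)) (1 : ℕ) 2
        simpa using h

/-- A finite set over `𝔽₂` lies in a translate of the span of its sumset with itself. -/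
theorem card_le_two_pow_finrank_span_add_self {M : Type*} [AddCommGroup M] [Module (ZMod 2) M]
    [DecidableEq M] (N : Finset M) (hN : N.Nonempty) :
    N.card ≤ 2 ^ Module.finrank (ZMod 2)
      (Submodule.span (ZMod 2) ((N + N : Finset M) : Set M)) := by
  obtain ⟨a, ha⟩ := hN
  have := Module.Finite.span_finset (ZMod 2) (N + N)
  have := Module.finite_of_finite (ZMod 2)
    (M := Submodule.span (ZMod 2) ((N + N : Finset M) : Set M))
  have h := Module.natCard_eq_pow_finrank (K := ZMod 2)
    (V := Submodule.span (ZMod 2) ((N + N : Finset M) : Set M))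
  rw [Nat.card_zmod] at h
  rw [← h, ← Nat.card_eq_finsetCard]
  refine Nat.card_le_card_of_injective
    (fun x : N => ⟨a + x, Submodule.subset_span (Finset.add_mem_add ha x.2)⟩) fun x y hxy => ?_
  exact Subtype.ext (add_left_cancel (Subtype.ext_iff.1 hxy))

/-- If the distinct vectors `v 1, …, v n` all lie in a subspace `H ≤ 𝔽₂^d`, and
the sets `N i ⊆ V = {v 1, …, v n}` satisfy conditions (i) and (ii), then
`∑ i, |N i| ≤ 2 * 3 ^ (dim H)`. -/
theorem statement3 {n d : ℕ} (H : Submodule (ZMod 2) (Fin d → ZMod 2))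
    (v : Fin n → (Fin d → ZMod 2)) (hv : Function.Injective v)
    (hvH : ∀ i, v i ∈ H)
    (N : Fin n → Finset (Fin d → ZMod 2))
    (hNV : ∀ i, N i ⊆ Finset.univ.image v)
    (h1 : ∀ i, (N i).image (fun w => v i + w) = N i)
    (h2 : ∀ i j : Fin n, j < i →
      v j ∉ Submodule.span (ZMod 2)
        (((N i + N i : Finset (Fin d → ZMod 2))) : Set (Fin d → ZMod 2))) :
    ∑ i, (N i).card ≤ 2 * 3 ^ (Module.finrank (ZMod 2) H) := by
  let W : Fin n → Submodule (ZMod 2) (Fin d → ZMod 2) := fun i =>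
    Submodule.span (ZMod 2) ((N i + N i : Finset (Fin d → ZMod 2)) : Set (Fin d → ZMod 2))
  have hNH : ∀ i, ∀ x ∈ N i, x ∈ H := fun i x hx => by
    obtain ⟨k, -, rfl⟩ := Finset.mem_image.1 (hNV i hx)
    exact hvH k
  have hWH : ∀ i, W i ≤ H := fun i => Submodule.span_le.2 fun x hx => by
    obtain ⟨y, hy, z, hz, rfl⟩ := Finset.mem_add.1 hx
    exact add_mem (hNH i y hy) (hNH i z hz)
  have hvW : ∀ i, (N i).Nonempty → v i ∈ W i := fun i ⟨a, ha⟩ => by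
    have hva : v i + a ∈ N i := by
      rw [← h1 i]
      exact Finset.mem_image_of_mem _ ha
    have h := Submodule.subset_span (R := ZMod 2) (Finset.add_mem_add hva ha)
    rwa [add_assoc, ZModModule.add_self, add_zero] at h
  have key := sum_two_pow_finrank_le_three_pow (M := H) (ι := {i // (N i).Nonempty})
    (fun i => ⟨v i, hvH i⟩) (fun i => (W i).comap H.subtype) (fun i => hvW i i.2)
    (fun i j hj => h2 i j hj)
  calc ∑ i, (N i).card = ∑ i with (N i).Nonempty, (N i).card := by
        rw [Finset.sum_filter_of_ne]
        intro i _ hi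
        exact Finset.card_ne_zero.1 hi
    _ = ∑ i : {i // (N i).Nonempty}, (N i).card :=
        Finset.sum_subtype _ (by simp) _
    _ ≤ ∑ i : {i // (N i).Nonempty},
          2 ^ Module.finrank (ZMod 2) ((W i).comap H.subtype) := by
        refine Finset.sum_le_sum fun i _ => ?_
        rw [(Submodule.comapSubtypeEquivOfLe (hWH i)).finrank_eq]
        exact card_le_two_pow_finrank_span_add_self (N i) i.2
    _ ≤ 3 ^ Module.finrank (ZMod 2) H := key
    _ ≤ 2 * 3 ^ Module.finrank (ZMod 2) H := Nat.le_mul_of_pos_left _ two_pos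
end

section
/- Let v_1, …, v_n be distinct vectors in 𝔽₂^d with V = {v_1, …, v_n}, and let N_1, …, N_n ⊆ V be finite sets satisfying condition (i): for all i ∈ [n], v_i + N_i = N_i. Then E₃(V) ≥ Σ_{i=1}^n |N_i|. -/
/-- The 3-energy of a finite set `A ⊆ 𝔽₂^d`: the number of triples summing to zero. -/
def energy3 {d : ℕ} (A : Finset (Fin d → ZMod 2)) : ℕ :=
  ((A ×ˢ A ×ˢ A).filter (fun p => p.1 + p.2.1 + p.2.2 = 0)).card

/-- If the `v i` are distinct, `V = {v 1, …, v n}`, `N i ⊆ V` and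
`v i + N i = N i` for all `i`, then `E₃(V) ≥ ∑ i, |N i|`. -/
theorem statement7 {n d : ℕ} (v : Fin n → (Fin d → ZMod 2)) (hv : Function.Injective v)
    (N : Fin n → Finset (Fin d → ZMod 2))
    (hNV : ∀ i, N i ⊆ Finset.univ.image v)
    (h1 : ∀ i, (N i).image (fun w => v i + w) = N i) :
    ∑ i, (N i).card ≤ energy3 (Finset.univ.image v) := by
  rw [← Finset.card_sigma]
  refine Finset.card_le_card_of_injOn (fun p => (v p.1, p.2, v p.1 + p.2)) ?_ ?_
  · rintro ⟨i, w⟩ hp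
    have hw : w ∈ N i := by simpa using hp
    have hvw : v i + w ∈ N i := by
      rw [← h1 i]
      exact Finset.mem_image_of_mem _ hw
    refine Finset.mem_coe.2 (Finset.mem_filter.2 ⟨?_, ?_⟩)
    · exact Finset.mem_product.2 ⟨Finset.mem_image_of_mem v (Finset.mem_univ i),
        Finset.mem_product.2 ⟨hNV i hw, hNV i hvw⟩⟩
    · exact funext fun k => CharTwo.add_self_eq_zero (v i k + w k)
  · rintro ⟨i, w⟩ - ⟨j, u⟩ - h
    simp only [Prod.mk.injEq] at h
    obtain ⟨hij, rfl, -⟩ := h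
    obtain rfl := hv hij
    rfl
end

section
/- There exists a constant c > 0 such that the following holds with ε = 0.0028. For all n ≥ 1 and d, and for every finite set V ⊆ 𝔽₂^d with |V| = n and E₄(V) ≥ n^{3 − 2ε}, there exists an 𝔽₂-linear subspace H ≤ 𝔽₂^d with |H| ≤ 2n and |V ∩ H| ≥ c · n^{1 − 73ε}. -/
open scoped Classical

/-- The 4-energy (additive energy) of a finite set `A ⊆ 𝔽₂^d`: the number of quadruples
summing to zero. -/
def energy4 {d : ℕ} (A : Finset (Fin d → ZMod 2)) : ℕ :=
  ((A ×ˢ A ×ˢ A ×ˢ A).filter (fun p => p.1 + p.2.1 + p.2.2.1 + p.2.2.2 = 0)).card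

/-! ### Shannon entropy on finite weighted spaces -/

section Entropy

open Real Finset

variable {Ω Ω' α β γ δ : Type*} [Fintype Ω] [Fintype Ω']

/-- The law of `X` under the weight function `p`. -/
noncomputable def law (p : Ω → ℝ) (X : Ω → α) (a : α) : ℝ :=
  ∑ ω, if X ω = a then p ω else 0

/-- The Shannon entropy of `X` under the weight function `p`. -/
noncomputable def ent (p : Ω → ℝ) (X : Ω → α) : ℝ :=
  -∑ ω, p ω * log (law p X (X ω))

/-- The product of two weight functions. -/
def prodw (p : Ω → ℝ) (q : Ω' → ℝ) (ω : Ω × Ω') : ℝ := p ω.1 * q ω.2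

lemma law_nonneg {p : Ω → ℝ} (hp : ∀ ω, 0 ≤ p ω) (X : Ω → α) (a : α) : 0 ≤ law p X a :=
  sum_nonneg fun ω _ => by split_ifs <;> simp [hp]

lemma le_law {p : Ω → ℝ} (hp : ∀ ω, 0 ≤ p ω) (X : Ω → α) (ω : Ω) : p ω ≤ law p X (X ω) := by
  have := single_le_sum (f := fun ω' => if X ω' = X ω then p ω' else 0)
    (fun i _ => by split_ifs <;> simp [hp]) (mem_univ ω)
  simpa [law] using this

lemma sum_law_mul [Fintype α] (p : Ω → ℝ) (X : Ω → α) (φ : α → ℝ) :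
    ∑ a, law p X a * φ a = ∑ ω, p ω * φ (X ω) := by
  simp only [law, sum_mul]
  rw [sum_comm]
  refine sum_congr rfl fun ω _ => ?_
  simp [ite_mul]

lemma sum_law [Fintype α] (p : Ω → ℝ) (X : Ω → α) : ∑ a, law p X a = ∑ ω, p ω := by
  simpa using sum_law_mul p X fun _ => 1

lemma law_mem [Fintype α] {p : Ω → ℝ} (hp : p ∈ stdSimplex ℝ Ω) (X : Ω → α) :
    law p X ∈ stdSimplex ℝ α :=
  ⟨law_nonneg hp.1 X, (sum_law p X).trans hp.2⟩

lemma prodw_mem {p : Ω → ℝ} {q : Ω' → ℝ} (hp : p ∈ stdSimplex ℝ Ω) (hq : q ∈ stdSimplex ℝ Ω') :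
    prodw p q ∈ stdSimplex ℝ (Ω × Ω') := by
  refine ⟨fun ω => mul_nonneg (hp.1 _) (hq.1 _), ?_⟩
  simp only [prodw, Fintype.sum_prod_type, ← mul_sum, hq.2, mul_one, hp.2]

lemma law_law [Fintype α] (p : Ω → ℝ) (X : Ω → α) (f : α → β) :
    law (law p X) f = law p fun ω => f (X ω) := by
  funext b
  have := sum_law_mul p X fun a => if f a = b then 1 else 0
  simpa [law] using this

lemma ent_law [Fintype α] (p : Ω → ℝ) (X : Ω → α) (f : α → β) :
    ent (law p X) f = ent p fun ω => f (X ω) := by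
  unfold ent
  rw [law_law, sum_law_mul p X fun a => log (law p (fun ω => f (X ω)) (f a))]

lemma law_id (p : Ω → ℝ) : law p (fun ω => ω) = p := by
  funext a; simp [law]

lemma ent_eq_sum_negMulLog [Fintype α] (p : Ω → ℝ) (X : Ω → α) :
    ent p X = ∑ a, negMulLog (law p X a) := by
  unfold ent negMulLog
  rw [← sum_law_mul p X fun a => log (law p X a), ← sum_neg_distrib]
  simp

lemma ent_congr (p : Ω → ℝ) {X : Ω → α} {Y : Ω → β}
    (h : ∀ ω ω', X ω = X ω' ↔ Y ω = Y ω') : ent p X = ent p Y := by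
  simp only [ent, law, h]

lemma ent_comp_equiv (p : Ω → ℝ) (e : Ω' ≃ Ω) (X : Ω → α) :
    ent (fun ω => p (e ω)) (fun ω => X (e ω)) = ent p X := by
  unfold ent law
  rw [← e.sum_comp fun ω => p ω * log _]
  congr 1
  refine sum_congr rfl fun ω _ => ?_
  rw [← e.sum_comp]

lemma ent_mono_of_support {p : Ω → ℝ} (hp : ∀ ω, 0 ≤ p ω) {X : Ω → α} {Y : Ω → β}
    (h : ∀ ω ω', p ω ≠ 0 → p ω' ≠ 0 → X ω = X ω' → Y ω = Y ω') : ent p Y ≤ ent p X := by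
  refine neg_le_neg (sum_le_sum fun ω _ => ?_)
  rcases (hp ω).eq_or_lt with h0 | h0
  · simp [← h0]
  · refine mul_le_mul_of_nonneg_left (log_le_log (h0.trans_le (le_law hp X ω)) ?_) h0.le
    refine sum_le_sum fun ω' _ => ?_
    by_cases hX : X ω' = X ω
    · by_cases h1 : p ω' = 0
      · simp [h1]
      · simp [hX, h _ _ h1 h0.ne' hX]
    · simp only [hX, if_false]; split_ifs <;> simp [hp]

lemma ent_pair_submodular {p : Ω → ℝ} (hp : ∀ ω, 0 ≤ p ω) {A : Ω → α} {B : Ω → β} {C : Ω → γ}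
    (hA : ∀ ω ω', p ω ≠ 0 → p ω' ≠ 0 → A ω = A ω' → C ω = C ω')
    (hB : ∀ ω ω', p ω ≠ 0 → p ω' ≠ 0 → B ω = B ω' → C ω = C ω') :
    ent p (fun ω => (A ω, B ω)) + ent p C ≤ ent p A + ent p B := by
  set LA := law p A with hLA
  set LB := law p B with hLB
  set LC := law p C with hLC
  set LJ := law p (fun ω => (A ω, B ω)) with hLJ
  have key : ∑ ω, p ω * (LA (A ω) * LB (B ω) / (LJ (A ω, B ω) * LC (C ω))) ≤ ∑ ω, p ω := by
    have e1 : ∀ ω, p ω * (LA (A ω) * LB (B ω) / (LJ (A ω, B ω) * LC (C ω))) =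
        ∑ ω₁, ∑ ω₂, if A ω₁ = A ω ∧ B ω₂ = B ω then
          (p ω₁ * p ω₂ / LC (C ω)) * (p ω / LJ (A ω, B ω)) else 0 := by
      intro ω
      have : LA (A ω) * LB (B ω) = ∑ ω₁, ∑ ω₂, if A ω₁ = A ω ∧ B ω₂ = B ω then
          p ω₁ * p ω₂ else 0 := by
        rw [hLA, hLB, law, law, sum_mul_sum]
        refine sum_congr rfl fun ω₁ _ => sum_congr rfl fun ω₂ _ => ?_
        by_cases h1 : A ω₁ = A ω <;> by_cases h2 : B ω₂ = B ω <;> simp [h1, h2]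
      rw [this, sum_div, mul_sum]
      refine sum_congr rfl fun ω₁ _ => ?_
      rw [sum_div, mul_sum]
      refine sum_congr rfl fun ω₂ _ => ?_
      split_ifs
      · rw [div_mul_div_comm, mul_comm (LJ _)]
        ring
      · simp
    have e2 : ∀ ω₁ ω₂, (∑ ω, if A ω₁ = A ω ∧ B ω₂ = B ω then
          (p ω₁ * p ω₂ / LC (C ω)) * (p ω / LJ (A ω, B ω)) else 0) ≤
          if C ω₂ = C ω₁ then p ω₁ * (p ω₂ / LC (C ω₁)) else 0 := by
      intro ω₁ ω₂
      by_cases z₁ : p ω₁ = 0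
      · simp [z₁]
      by_cases z₂ : p ω₂ = 0
      · simp [z₂]
      by_cases hC : C ω₂ = C ω₁
      · rw [if_pos hC]
        have : ∀ ω, (if A ω₁ = A ω ∧ B ω₂ = B ω then
          (p ω₁ * p ω₂ / LC (C ω)) * (p ω / LJ (A ω, B ω)) else 0) =
          (p ω₁ * p ω₂ / LC (C ω₁)) * ((if (A ω, B ω) = (A ω₁, B ω₂) then p ω else 0) /
            LJ (A ω₁, B ω₂)) := by
          intro ω
          by_cases z : p ω = 0
          · simp [z]
          by_cases h : A ω₁ = A ω ∧ B ω₂ = B ω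
          · rw [if_pos h, if_pos (by rw [h.1, h.2]), hA _ _ z₁ z h.1, h.1, h.2]
          · rw [if_neg h, if_neg (by rw [Prod.mk.injEq]; tauto)]; simp
        simp only [this]
        rw [← mul_sum, ← sum_div]
        have h1 : (∑ ω, if (A ω, B ω) = (A ω₁, B ω₂) then p ω else 0) = LJ (A ω₁, B ω₂) := by
          unfold LJ law; congr! 2
        rw [h1, mul_div_assoc]
        refine mul_le_of_le_one_right (mul_nonneg (hp _) (div_nonneg (hp _) (law_nonneg hp _ _))) ?_
        exact div_self_le_one _
      · rw [if_neg hC]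
        refine (sum_eq_zero fun ω _ => ?_).le
        by_cases z : p ω = 0
        · simp [z]
        refine if_neg ?_
        rintro ⟨h1, h2⟩
        exact hC ((hB _ _ z₂ z h2).trans (hA _ _ z₁ z h1).symm)
    calc _ = ∑ ω, ∑ ω₁, ∑ ω₂, _ := sum_congr rfl fun ω _ => e1 ω
      _ = ∑ ω₁, ∑ ω₂, ∑ ω, _ := by
        rw [sum_comm]
        exact sum_congr rfl fun _ _ => sum_comm
      _ ≤ ∑ ω₁, ∑ ω₂, _ := sum_le_sum fun ω₁ _ => sum_le_sum fun ω₂ _ => e2 ω₁ ω₂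
      _ ≤ ∑ ω₁, p ω₁ := by
        refine sum_le_sum fun ω₁ _ => ?_
        have : ∀ ω₂, (if C ω₂ = C ω₁ then p ω₁ * (p ω₂ / LC (C ω₁)) else 0) =
            p ω₁ * ((if C ω₂ = C ω₁ then p ω₂ else 0) / LC (C ω₁)) := by
          intro ω₂; split_ifs <;> simp
        simp only [this]
        rw [← mul_sum, ← sum_div]
        exact mul_le_of_le_one_right (hp _) (div_self_le_one _)
  have pt : ∀ ω, p ω * log (LA (A ω)) + p ω * log (LB (B ω)) ≤
      p ω * log (LJ (A ω, B ω)) + p ω * log (LC (C ω)) +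
      (p ω * (LA (A ω) * LB (B ω) / (LJ (A ω, B ω) * LC (C ω))) - p ω) := by
    intro ω
    rcases (hp ω).eq_or_lt with h0 | h0
    · simp [← h0]
    · have a1 : 0 < LA (A ω) := h0.trans_le (le_law hp A ω)
      have a2 : 0 < LB (B ω) := h0.trans_le (le_law hp B ω)
      have a3 : 0 < LC (C ω) := h0.trans_le (le_law hp C ω)
      have a4 : 0 < LJ (A ω, B ω) := h0.trans_le (le_law hp (fun ω => (A ω, B ω)) ω)
      have := log_le_sub_one_of_pos (div_pos (mul_pos a1 a2) (mul_pos a4 a3))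
      rw [log_div (by positivity) (by positivity), log_mul a1.ne' a2.ne', log_mul a4.ne' a3.ne']
        at this
      nlinarith
  have := sum_le_sum fun ω (_ : ω ∈ univ) => pt ω
  simp only [sum_add_distrib, sum_sub_distrib] at this
  simp only [ent]
  linarith

/-- Submodularity of entropy: if, on the support of `p`, `A` and `B` both determine `C` and jointly
determine `J`, then `H(J) + H(C) ≤ H(A) + H(B)`. -/
lemma ent_submodular_of_support {p : Ω → ℝ} (hp : ∀ ω, 0 ≤ p ω) {J : Ω → δ} {A : Ω → α}
    {B : Ω → β} {C : Ω → γ} (hA : ∀ ω ω', p ω ≠ 0 → p ω' ≠ 0 → A ω = A ω' → C ω = C ω')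
    (hB : ∀ ω ω', p ω ≠ 0 → p ω' ≠ 0 → B ω = B ω' → C ω = C ω')
    (hJ : ∀ ω ω', p ω ≠ 0 → p ω' ≠ 0 → A ω = A ω' → B ω = B ω' → J ω = J ω') :
    ent p J + ent p C ≤ ent p A + ent p B := by
  refine le_trans ?_ (ent_pair_submodular hp hA hB)
  gcongr
  exact ent_mono_of_support hp fun ω ω' z z' h =>
    hJ _ _ z z' (congrArg Prod.fst h) (congrArg Prod.snd h)

lemma ent_submodular {p : Ω → ℝ} (hp : ∀ ω, 0 ≤ p ω) {J : Ω → δ} {A : Ω → α} {B : Ω → β}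
    {C : Ω → γ} (hA : ∀ ω ω', A ω = A ω' → C ω = C ω') (hB : ∀ ω ω', B ω = B ω' → C ω = C ω')
    (hJ : ∀ ω ω', A ω = A ω' → B ω = B ω' → J ω = J ω') :
    ent p J + ent p C ≤ ent p A + ent p B :=
  ent_submodular_of_support hp (fun ω ω' _ _ => hA ω ω') (fun ω ω' _ _ => hB ω ω')
    (fun ω ω' _ _ => hJ ω ω')

lemma ent_const {p : Ω → ℝ} (hp : p ∈ stdSimplex ℝ Ω) (c : α) : ent p (fun _ => c) = 0 := by
  simp [ent, law, hp.2]

lemma ent_pair_le {p : Ω → ℝ} (hp : p ∈ stdSimplex ℝ Ω) {J : Ω → δ} {A : Ω → α} {B : Ω → β}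
    (hJ : ∀ ω ω', A ω = A ω' → B ω = B ω' → J ω = J ω') :
    ent p J ≤ ent p A + ent p B := by
  have := ent_submodular hp.1 (J := J) (A := A) (B := B) (C := fun _ => ()) (by simp) (by simp) hJ
  rwa [ent_const hp, add_zero] at this

lemma law_prodw (p : Ω → ℝ) (q : Ω' → ℝ) (X : Ω → α) (Y : Ω' → β) (a : α) (b : β) :
    law (prodw p q) (fun ω => (X ω.1, Y ω.2)) (a, b) = law p X a * law q Y b := by
  simp only [law, Fintype.sum_prod_type, sum_mul_sum, prodw]
  refine sum_congr rfl fun ω₁ _ => sum_congr rfl fun ω₂ _ => ?_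
  by_cases h1 : X ω₁ = a <;> by_cases h2 : Y ω₂ = b <;> simp [h1, h2]

lemma law_prodw_fst (p : Ω → ℝ) {q : Ω' → ℝ} (hq : ∑ ω, q ω = 1) (X : Ω → α) :
    law (prodw p q) (fun ω => X ω.1) = law p X := by
  funext a
  simp only [law, Fintype.sum_prod_type, prodw]
  refine sum_congr rfl fun ω₁ _ => ?_
  split_ifs <;> simp [← mul_sum, hq]

lemma law_prodw_snd {p : Ω → ℝ} (hp : ∑ ω, p ω = 1) (q : Ω' → ℝ) (Y : Ω' → β) :
    law (prodw p q) (fun ω => Y ω.2) = law q Y := by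
  funext a
  simp only [law, Fintype.sum_prod_type_right, prodw]
  refine sum_congr rfl fun ω₁ _ => ?_
  split_ifs <;> simp [← sum_mul, hp]

lemma sum_prodw_fst (p : Ω → ℝ) {q : Ω' → ℝ} (hq : ∑ ω, q ω = 1) (φ : Ω → ℝ) :
    ∑ ω, prodw p q ω * φ ω.1 = ∑ ω, p ω * φ ω := by
  simp only [prodw, Fintype.sum_prod_type]
  refine sum_congr rfl fun ω _ => ?_
  rw [← sum_mul, ← mul_sum, hq, mul_one]

lemma sum_prodw_snd {p : Ω → ℝ} (hp : ∑ ω, p ω = 1) (q : Ω' → ℝ) (φ : Ω' → ℝ) :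
    ∑ ω, prodw p q ω * φ ω.2 = ∑ ω, q ω * φ ω := by
  simp only [prodw, Fintype.sum_prod_type_right, mul_assoc, ← sum_mul, hp, one_mul]

lemma ent_prodw_fst (p : Ω → ℝ) {q : Ω' → ℝ} (hq : ∑ ω, q ω = 1) (X : Ω → α) :
    ent (prodw p q) (fun ω => X ω.1) = ent p X := by
  simp only [ent, law_prodw_fst p hq]
  rw [sum_prodw_fst p hq fun ω => log (law p X (X ω))]

lemma ent_prodw_snd {p : Ω → ℝ} (hp : ∑ ω, p ω = 1) (q : Ω' → ℝ) (Y : Ω' → β) :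
    ent (prodw p q) (fun ω => Y ω.2) = ent q Y := by
  simp only [ent, law_prodw_snd hp q]
  rw [sum_prodw_snd hp q fun ω => log (law q Y (Y ω))]

lemma ent_prodw {p : Ω → ℝ} {q : Ω' → ℝ} (hp : p ∈ stdSimplex ℝ Ω) (hq : q ∈ stdSimplex ℝ Ω')
    (X : Ω → α) (Y : Ω' → β) :
    ent (prodw p q) (fun ω => (X ω.1, Y ω.2)) = ent p X + ent q Y := by
  rw [← ent_prodw_fst p hq.2 X, ← ent_prodw_snd hp.2 q Y]
  simp only [ent, ← neg_add, ← sum_add_distrib]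
  congr 1
  refine sum_congr rfl fun ω _ => ?_
  rw [law_prodw, law_prodw_fst p hq.2, law_prodw_snd hp.2 q]
  have h1 := le_law hp.1 X ω.1
  have h2 := le_law hq.1 Y ω.2
  rcases (hp.1 ω.1).eq_or_lt with h | h
  · simp [prodw, ← h]
  rcases (hq.1 ω.2).eq_or_lt with h' | h'
  · simp [prodw, ← h']
  rw [log_mul (h.trans_le h1).ne' (h'.trans_le h2).ne', mul_add]

end Entropy

/-! ### Conditioning and entropic Ruzsa distance -/

section Conditioning

open Real Finset

variable {Ω Ω' α β ζ ξ σ G : Type*} [Fintype Ω] [Fintype Ω'] [Fintype ζ] [Fintype ξ] [Fintype σ]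
  [AddCommGroup G] [Fintype G]

/-- The weight function `p` conditioned on the event `Z = z`. -/
noncomputable def condw (p : Ω → ℝ) (Z : Ω → ζ) (z : ζ) (ω : Ω) : ℝ :=
  if Z ω = z then p ω / law p Z z else 0

omit [Fintype ζ] in
lemma condw_mem {p : Ω → ℝ} (hp : ∀ ω, 0 ≤ p ω) {Z : Ω → ζ} {z : ζ} (hz : law p Z z ≠ 0) :
    condw p Z z ∈ stdSimplex ℝ Ω := by
  refine ⟨fun ω => ?_, ?_⟩
  · unfold condw
    split_ifs
    · exact div_nonneg (hp _) (law_nonneg hp _ _)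
    · rfl
  · have : ∀ ω, condw p Z z ω = (if Z ω = z then p ω else 0) / law p Z z := by
      intro ω; unfold condw; split_ifs <;> simp
    simp only [this, ← sum_div]
    exact div_self hz

omit [Fintype ζ] in
lemma law_condw (p : Ω → ℝ) (Z : Ω → ζ) (z : ζ) (X : Ω → α) (x : α) :
    law (condw p Z z) X x = law p (fun ω => (X ω, Z ω)) (x, z) / law p Z z := by
  rw [law, law, sum_div]
  refine sum_congr rfl fun ω _ => ?_
  by_cases h1 : X ω = x <;> by_cases h2 : Z ω = z <;> simp [condw, h1, h2]

/-- The chain rule for entropy. -/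
lemma sum_law_mul_ent_condw {p : Ω → ℝ} (hp : ∀ ω, 0 ≤ p ω) (Z : Ω → ζ) (X : Ω → α) :
    ∑ z, law p Z z * ent (condw p Z z) X = ent p (fun ω => (X ω, Z ω)) - ent p Z := by
  have h : ∀ z, law p Z z * ent (condw p Z z) X =
      ∑ ω, if Z ω = z then -(p ω * log (law p (fun ω => (X ω, Z ω)) (X ω, z) / law p Z z))
        else 0 := by
    intro z
    rw [ent, ← sum_neg_distrib, mul_sum]
    refine sum_congr rfl fun ω _ => ?_
    rw [law_condw, condw]
    split_ifs with hz
    · have : law p Z z = 0 → p ω = 0 := fun h =>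
        le_antisymm ((le_law hp Z ω).trans (by rw [hz, h])) (hp ω)
      by_cases h0 : law p Z z = 0
      · simp [h0, this h0]
      · field_simp
    · simp
  simp only [h]
  rw [sum_comm]
  simp only [ent, sum_ite_eq, mem_univ, if_true]
  rw [neg_sub_neg, ← sum_sub_distrib]
  refine sum_congr rfl fun ω _ => ?_
  rcases (hp ω).eq_or_lt with h0 | h0
  · simp [← h0]
  · rw [log_div (h0.trans_le (le_law hp (fun ω => (X ω, Z ω)) ω)).ne'
      (h0.trans_le (le_law hp Z ω)).ne']
    ring

omit [Fintype ζ] [Fintype ξ] in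
lemma condw_prodw (p : Ω → ℝ) (q : Ω' → ℝ) (Z : Ω → ζ) (W : Ω' → ξ) (z : ζ) (w : ξ) :
    condw (prodw p q) (fun ω => (Z ω.1, W ω.2)) (z, w) = prodw (condw p Z z) (condw q W w) := by
  funext ω
  rw [condw, law_prodw]
  by_cases h1 : Z ω.1 = z <;> by_cases h2 : W ω.2 = w <;>
    simp [condw, prodw, h1, h2, mul_div_mul_comm]

omit [Fintype ζ] in
lemma condw_prodw_snd {p : Ω' → ℝ} (hp : ∑ ω, p ω = 1) (q : Ω → ℝ) (Z : Ω → ζ) (z : ζ) :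
    condw (prodw p q) (fun ω => Z ω.2) z = prodw p (condw q Z z) := by
  funext ω
  rw [condw, law_prodw_snd hp]
  by_cases h1 : Z ω.2 = z <;> simp [condw, prodw, h1, mul_div_assoc]

/-- The entropic Ruzsa distance of two weight functions (in characteristic two). -/
noncomputable def rdist (f g : G → ℝ) : ℝ :=
  ent (prodw f g) (fun ω => ω.1 + ω.2) - (ent f (fun x => x) + ent g (fun x => x)) / 2

lemma rdist_law (p : Ω → ℝ) (q : Ω' → ℝ) (P : Ω → G) (Q : Ω' → G) :
    rdist (law p P) (law q Q) =
      ent (prodw p q) (fun ω => P ω.1 + Q ω.2) - (ent p P + ent q Q) / 2 := by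
  have : prodw (law p P) (law q Q) = law (prodw p q) (fun ω => (P ω.1, Q ω.2)) := by
    funext ω
    rw [law_prodw, prodw]
  rw [rdist, this, ent_law, ent_law, ent_law]

lemma rdist_law_right (f : G → ℝ) (q : Ω' → ℝ) (Q : Ω' → G) :
    rdist f (law q Q) =
      ent (prodw f q) (fun ω => ω.1 + Q ω.2) - (ent f (fun x => x) + ent q Q) / 2 := by
  have := rdist_law f q (fun x => x) Q
  rwa [law_id] at this

/-- The conditional Ruzsa distance between `f` and `P` given `Z`. -/
noncomputable def cdist (f : G → ℝ) (p : Ω → ℝ) (P : Ω → G) (Z : Ω → ζ) : ℝ :=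
  ent (prodw f p) (fun ω => (ω.1 + P ω.2, Z ω.2)) - ent p Z
    - (ent f (fun x => x) + (ent p (fun ω => (P ω, Z ω)) - ent p Z)) / 2

lemma sum_law_mul_rdist {f : G → ℝ} {p : Ω → ℝ} (hf : f ∈ stdSimplex ℝ G)
    (hp : p ∈ stdSimplex ℝ Ω) (P : Ω → G) (Z : Ω → ζ) :
    ∑ z, law p Z z * rdist f (law (condw p Z z) P) = cdist f p P Z := by
  have h1 := sum_law_mul_ent_condw (prodw_mem hf hp).1 (fun ω => Z ω.2) (fun ω => ω.1 + P ω.2)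
  have h2 := sum_law_mul_ent_condw hp.1 Z P
  simp only [condw_prodw_snd hf.2, law_prodw_snd hf.2, ent_prodw_snd hf.2] at h1
  have h3 : ∑ z, law p Z z = 1 := (sum_law p Z).trans hp.2
  rw [cdist, ← h1, ← h2]
  have : ent f (fun x => x) = ∑ z, law p Z z * ent f (fun x => x) := by
    rw [← sum_mul, h3, one_mul]
  rw [this, ← sum_add_distrib, sum_div, ← sum_sub_distrib]
  refine sum_congr rfl fun z _ => ?_
  rw [rdist_law_right]
  ring

lemma rdist_law_eq_cdist {f : G → ℝ} {p : Ω → ℝ} (hf : f ∈ stdSimplex ℝ G)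
    (hp : p ∈ stdSimplex ℝ Ω) (P : Ω → G) :
    rdist f (law p P) = cdist f p P (fun _ => ()) := by
  rw [rdist_law_right, cdist, ent_const hp]
  rw [ent_congr (prodw f p) (X := fun ω => (ω.1 + P ω.2, ())) (Y := fun ω => ω.1 + P ω.2)
    (by simp), ent_congr p (X := fun ω => (P ω, ())) (Y := P) (by simp)]
  ring

lemma le_sum_law_mul {p : Ω → ℝ} (hp : p ∈ stdSimplex ℝ Ω) (Z : Ω → ζ) {T : ℝ} {φ : ζ → ℝ}
    (h : ∀ z, law p Z z ≠ 0 → T ≤ φ z) : T ≤ ∑ z, law p Z z * φ z := by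
  have h3 : ∑ z, law p Z z = 1 := (sum_law p Z).trans hp.2
  calc T = ∑ z, law p Z z * T := by rw [← sum_mul, h3, one_mul]
    _ ≤ _ := sum_le_sum fun z _ => by
      by_cases hz : law p Z z = 0
      · simp [hz]
      · exact mul_le_mul_of_nonneg_left (h z hz) (law_nonneg hp.1 _ _)

/-- Two conditionally independent copies of `p`, given `Z`. -/
noncomputable def condprod (p : Ω → ℝ) (Z : Ω → ζ) (ω : Ω × Ω) : ℝ :=
  if Z ω.2 = Z ω.1 then p ω.1 * p ω.2 / law p Z (Z ω.1) else 0

omit [Fintype ζ] in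
lemma condprod_nonneg {p : Ω → ℝ} (hp : ∀ ω, 0 ≤ p ω) (Z : Ω → ζ) (ω : Ω × Ω) :
    0 ≤ condprod p Z ω := by
  unfold condprod
  split_ifs
  · exact div_nonneg (mul_nonneg (hp _) (hp _)) (law_nonneg hp _ _)
  · rfl

omit [Fintype ζ] in
lemma condprod_swap (p : Ω → ℝ) (Z : Ω → ζ) (ω : Ω × Ω) :
    condprod p Z ω.swap = condprod p Z ω := by
  unfold condprod
  simp only [Prod.fst_swap, Prod.snd_swap]
  by_cases h : Z ω.1 = Z ω.2
  · rw [if_pos h, if_pos h.symm, h, mul_comm]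
  · rw [if_neg h, if_neg (Ne.symm h)]

omit [Fintype ζ] in
lemma law_condprod_id_fst {p : Ω → ℝ} (hp : ∀ ω, 0 ≤ p ω) (Z : Ω → ζ) :
    law (condprod p Z) (fun ω => ω.1) = p := by
  funext a
  rw [law, Fintype.sum_prod_type]
  have : ∀ x, (∑ y, if x = a then condprod p Z (x, y) else 0) =
      if x = a then ∑ y, condprod p Z (a, y) else 0 := by
    intro x
    by_cases h : x = a <;> simp [h]
  simp only [this, sum_ite_eq', mem_univ, if_true]
  have : ∀ y, condprod p Z (a, y) = p a * ((if Z y = Z a then p y else 0) / law p Z (Z a)) := by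
    intro y
    simp only [condprod]
    split_ifs <;> simp [mul_div_assoc]
  simp only [this]
  rw [← mul_sum, ← sum_div]
  change p a * (law p Z (Z a) / law p Z (Z a)) = p a
  by_cases h : law p Z (Z a) = 0
  · rw [le_antisymm ((le_law hp Z a).trans h.le) (hp a), zero_mul]
  · rw [div_self h, mul_one]

omit [Fintype ζ] in
lemma law_condprod_fst {p : Ω → ℝ} (hp : ∀ ω, 0 ≤ p ω) (Z : Ω → ζ) (X : Ω → α) :
    law (condprod p Z) (fun ω => X ω.1) = law p X := by
  rw [← law_law (condprod p Z) (fun ω => ω.1) X, law_condprod_id_fst hp]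

omit [Fintype ζ] in
lemma ent_condprod_fst {p : Ω → ℝ} (hp : ∀ ω, 0 ≤ p ω) (Z : Ω → ζ) (X : Ω → α) :
    ent (condprod p Z) (fun ω => X ω.1) = ent p X := by
  rw [← ent_law (condprod p Z) (fun ω => ω.1) X, law_condprod_id_fst hp]

omit [Fintype ζ] in
lemma ent_condprod_snd {p : Ω → ℝ} (hp : ∀ ω, 0 ≤ p ω) (Z : Ω → ζ) (X : Ω → α) :
    ent (condprod p Z) (fun ω => X ω.2) = ent p X := by
  rw [← ent_condprod_fst hp Z X,
    ← ent_comp_equiv (condprod p Z) (Equiv.prodComm Ω Ω) fun ω => X ω.1]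
  congr 1
  funext ω
  exact (condprod_swap p Z ω).symm

omit [Fintype ζ] in
lemma condw_condprod {p : Ω → ℝ} (hp : ∀ ω, 0 ≤ p ω) (Z : Ω → ζ) (z : ζ) :
    condw (condprod p Z) (fun ω => Z ω.1) z = prodw (condw p Z z) (condw p Z z) := by
  funext ω
  rw [condw, law_condprod_fst hp, prodw, condw, condw, condprod]
  by_cases h1 : Z ω.1 = z <;> by_cases h2 : Z ω.2 = z <;> simp [h1, h2]
  rw [div_mul_div_comm, div_div]

/-- The entropic Balog–Szemerédi–Gowers lemma. -/
theorem sum_rdist_condw_le (h2 : ∀ x : G, x + x = 0) {p : Ω → ℝ} (hp : p ∈ stdSimplex ℝ Ω)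
    (A B : Ω → G) (S : Ω → σ) :
    ∑ z, law p (fun ω => (A ω + B ω, S ω)) z *
        rdist (law (condw p (fun ω => (A ω + B ω, S ω)) z) A)
          (law (condw p (fun ω => (A ω + B ω, S ω)) z) B) ≤
      2 * (ent p (fun ω => (A ω, S ω)) + ent p (fun ω => (B ω, S ω)))
        - 3 * ent p (fun ω => (A ω, B ω, S ω)) - 3 * ent p S
        + 2 * ent p (fun ω => (A ω + B ω, S ω)) := by
  set Z : Ω → G × σ := fun ω => (A ω + B ω, S ω) with hZ
  set q := condprod p Z with hq
  have hq0 : ∀ ω, 0 ≤ q ω := condprod_nonneg hp.1 Z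
  have supp : ∀ ω, q ω ≠ 0 → A ω.2 + B ω.2 = A ω.1 + B ω.1 ∧ S ω.2 = S ω.1 := by
    intro ω h
    by_contra hne
    exact h (if_neg fun h' => hne (by simpa [hZ] using h'))
  have cA := sum_law_mul_ent_condw hp.1 Z A
  have cB := sum_law_mul_ent_condw hp.1 Z B
  have cJ := sum_law_mul_ent_condw hp.1 Z (fun ω => (A ω, B ω, S ω))
  have cS := sum_law_mul_ent_condw hq0 (fun ω => Z ω.1) (fun ω => A ω.1 + B ω.2)
  have cJ' := sum_law_mul_ent_condw hq0 (fun ω => Z ω.1)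
    (fun ω => ((A ω.1, B ω.1, S ω.1), (A ω.2, B ω.2, S ω.2)))
  simp only [hq, condw_condprod hp.1, law_condprod_fst hp.1, ent_condprod_fst hp.1] at cS cJ'
  have e1 : ent p (fun ω => (A ω, Z ω)) = ent p (fun ω => (A ω, B ω, S ω)) :=
    ent_congr p fun ω ω' => by simp only [hZ, Prod.mk.injEq]; grind
  have e2 : ent p (fun ω => (B ω, Z ω)) = ent p (fun ω => (A ω, B ω, S ω)) :=
    ent_congr p fun ω ω' => by simp only [hZ, Prod.mk.injEq]; grind
  have e3 : ent p (fun ω => ((A ω, B ω, S ω), Z ω)) = ent p (fun ω => (A ω, B ω, S ω)) :=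
    ent_congr p fun ω ω' => by simp only [hZ, Prod.mk.injEq]; grind
  have cJ2 : ∑ z, law p Z z * ent (prodw (condw p Z z) (condw p Z z))
      (fun ω => ((A ω.1, B ω.1, S ω.1), (A ω.2, B ω.2, S ω.2))) =
      2 * ∑ z, law p Z z * ent (condw p Z z) (fun ω => (A ω, B ω, S ω)) := by
    rw [mul_sum]
    refine sum_congr rfl fun z _ => ?_
    by_cases hz : law p Z z = 0
    · simp [hz]
    · rw [ent_prodw (condw_mem hp.1 hz) (condw_mem hp.1 hz) (fun ω => (A ω, B ω, S ω))
        (fun ω => (A ω, B ω, S ω))]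
      ring
  rw [cJ', cJ, e3] at cJ2
  have hsum : ∑ z, law p Z z * rdist (law (condw p Z z) A) (law (condw p Z z) B) =
      (ent q (fun ω => (A ω.1 + B ω.2, Z ω.1)) - ent p Z)
        - ((ent p (fun ω => (A ω, Z ω)) - ent p Z)
          + (ent p (fun ω => (B ω, Z ω)) - ent p Z)) / 2 := by
    rw [← cS, ← cA, ← cB, ← sum_add_distrib, sum_div, ← sum_sub_distrib]
    refine sum_congr rfl fun z _ => ?_
    rw [rdist_law]
    ring
  have s1 := ent_submodular hq0 (J := fun ω => (A ω.1 + B ω.2, Z ω.1))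
    (A := fun ω => (A ω.1 + B ω.2, S ω.1)) (B := fun ω => Z ω.1) (C := fun ω => S ω.1)
    (by simp) (by simp [hZ]) (by simp only [hZ, Prod.mk.injEq]; tauto)
  have s2 := ent_submodular_of_support hq0
    (J := fun ω => (((A ω.1, B ω.1, S ω.1), (A ω.2, B ω.2, S ω.2)), Z ω.1))
    (A := fun ω => (A ω.1, B ω.2, S ω.1)) (B := fun ω => (A ω.2, B ω.1, S ω.1))
    (C := fun ω => (A ω.1 + B ω.2, S ω.1))
    (by intro ω ω' z z'; simp only [Prod.mk.injEq]; grind)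
    (by
      intro ω ω' z z'
      have := supp ω z
      have := supp ω' z'
      have := h2 (B ω.1)
      have := h2 (B ω.2)
      have := h2 (B ω'.1)
      have := h2 (B ω'.2)
      simp only [Prod.mk.injEq]
      grind)
    (by
      intro ω ω' z z'
      have := supp ω z
      have := supp ω' z'
      simp only [Prod.mk.injEq, hZ]
      grind)
  have s3 := ent_submodular_of_support hq0 (J := fun ω => (A ω.1, B ω.2, S ω.1))
    (A := fun ω => (A ω.1, S ω.1)) (B := fun ω => (B ω.2, S ω.2)) (C := fun ω => S ω.1)
    (by simp) (by
      intro ω ω' z z'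
      have := supp ω z
      have := supp ω' z'
      simp only [Prod.mk.injEq]
      grind) (by simp only [Prod.mk.injEq]; tauto)
  have s4 := ent_submodular_of_support hq0 (J := fun ω => (A ω.2, B ω.1, S ω.1))
    (A := fun ω => (A ω.2, S ω.2)) (B := fun ω => (B ω.1, S ω.1)) (C := fun ω => S ω.1)
    (by
      intro ω ω' z z'
      have := supp ω z
      have := supp ω' z'
      simp only [Prod.mk.injEq]
      grind) (by simp) (by simp only [Prod.mk.injEq]; tauto)
  rw [ent_condprod_fst hp.1 Z S] at s1 s3 s4
  rw [ent_condprod_fst hp.1 Z Z] at s1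
  rw [ent_condprod_fst hp.1 Z (fun ω => (A ω, S ω)),
    ent_condprod_snd hp.1 Z (fun ω => (B ω, S ω))] at s3
  rw [ent_condprod_snd hp.1 Z (fun ω => (A ω, S ω)),
    ent_condprod_fst hp.1 Z (fun ω => (B ω, S ω))] at s4
  rw [hsum, e1, e2]
  linarith

end Conditioning

/-! ### Minimizers of the distance functional -/

section Minimizer

open Real Finset

variable {Ω Ω' ζ ξ σ G : Type*} [Fintype Ω] [Fintype Ω'] [Fintype ζ] [Fintype ξ] [Fintype σ]
  [AddCommGroup G] [Fintype G]

omit [AddCommGroup G] [Fintype G] in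
lemma ent_prodw_map {α β γ : Type*} [Fintype α] [Fintype β] (p : Ω → ℝ) (q : Ω' → ℝ) (X : Ω → α)
    (Y : Ω' → β) (φ : α × β → γ) :
    ent (prodw p q) (fun ω => φ (X ω.1, Y ω.2)) = ent (prodw (law p X) (law q Y)) φ := by
  have : prodw (law p X) (law q Y) = law (prodw p q) (fun ω => (X ω.1, Y ω.2)) := by
    funext ω
    rw [law_prodw, prodw]
  rw [this, ent_law]

lemma rdist_comm (f g : G → ℝ) : rdist f g = rdist g f := by
  have h := ent_comp_equiv (prodw f g) (Equiv.prodComm G G) fun ω => ω.1 + ω.2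
  have h1 : (fun ω : G × G => prodw f g (Equiv.prodComm G G ω)) = prodw g f := by
    funext ω; simp [prodw, mul_comm]
  have h2 : (fun ω : G × G => (Equiv.prodComm G G ω).1 + (Equiv.prodComm G G ω).2) =
      fun ω => ω.1 + ω.2 := by
    funext ω; simp [add_comm]
  rw [h1, h2] at h
  rw [rdist, rdist, h, add_comm (ent f _)]

omit [Fintype G] in
/-- For independent `A`, `B`, `C`: `H(A + B + C) + H(B) ≤ H(A + B) + H(B + C)`. -/
lemma ent_add_add_le {p : Ω → ℝ} (hp : p ∈ stdSimplex ℝ Ω) (A B C : Ω → G)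
    (h : ent p A + ent p B + ent p C ≤ ent p (fun ω => (A ω, B ω, C ω))) :
    ent p (fun ω => A ω + B ω + C ω) + ent p B ≤
      ent p (fun ω => A ω + B ω) + ent p (fun ω => B ω + C ω) := by
  have s := ent_submodular hp.1 (J := fun ω => (A ω, B ω, C ω))
    (A := fun ω => (A ω, B ω + C ω)) (B := fun ω => (A ω + B ω, C ω))
    (C := fun ω => A ω + B ω + C ω)
    (by intro ω ω'; simp only [Prod.mk.injEq]; grind)
    (by intro ω ω'; simp only [Prod.mk.injEq]; grind)
    (by intro ω ω'; simp only [Prod.mk.injEq]; grind)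
  have s1 := ent_pair_le hp (J := fun ω => (A ω, B ω + C ω)) (A := A) (B := fun ω => B ω + C ω)
    (by simp only [Prod.mk.injEq]; tauto)
  have s2 := ent_pair_le hp (J := fun ω => (A ω + B ω, C ω)) (A := fun ω => A ω + B ω) (B := C)
    (by simp only [Prod.mk.injEq]; tauto)
  linarith

lemma rdist_law_add_le {f : G → ℝ} {p : Ω → ℝ} (hf : f ∈ stdSimplex ℝ G)
    (hp : p ∈ stdSimplex ℝ Ω) (A C : Ω → G)
    (h : ent p A + ent p C ≤ ent p (fun ω => (A ω, C ω))) :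
    rdist f (law p (fun ω => A ω + C ω)) ≤
      rdist f (law p A) + (ent p (fun ω => A ω + C ω) - ent p A) / 2 := by
  have s := ent_add_add_le (prodw_mem hf hp) (fun ω => ω.1) (fun ω => A ω.2) (fun ω => C ω.2) (by
    rw [ent_prodw_fst f hp.2 (fun x => x), ent_prodw_snd hf.2, ent_prodw_snd hf.2,
      ent_prodw hf hp (fun x => x) (fun ω => (A ω, C ω))]
    linarith)
  rw [ent_prodw_snd hf.2, ent_prodw_snd hf.2 p (fun ω => A ω + C ω)] at s
  rw [rdist_law_right, rdist_law_right]
  simp only [add_assoc] at s ⊢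
  linarith

omit [Fintype ζ] in
lemma cdist_le {f : G → ℝ} {p : Ω → ℝ} (hf : f ∈ stdSimplex ℝ G) (hp : p ∈ stdSimplex ℝ Ω)
    (P : Ω → G) (Z : Ω → ζ) :
    cdist f p P Z ≤
      rdist f (law p P) + (ent p P + ent p Z - ent p (fun ω => (P ω, Z ω))) / 2 := by
  have s := ent_pair_le (prodw_mem hf hp) (J := fun ω => (ω.1 + P ω.2, Z ω.2))
    (A := fun ω => ω.1 + P ω.2) (B := fun ω => Z ω.2) (by simp only [Prod.mk.injEq]; tauto)
  rw [ent_prodw_snd hf.2] at s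
  rw [rdist_law_right, cdist]
  linarith

omit [Fintype ζ] [Fintype σ] in
lemma cdist_pair_le {f : G → ℝ} {p : Ω → ℝ} (hf : f ∈ stdSimplex ℝ G) (hp : p ∈ stdSimplex ℝ Ω)
    (P : Ω → G) (Z : Ω → ζ) (S : Ω → σ) :
    cdist f p P (fun ω => (Z ω, S ω)) ≤ cdist f p P S + (ent p (fun ω => (P ω, S ω))
      + ent p (fun ω => (Z ω, S ω)) - ent p (fun ω => (P ω, Z ω, S ω)) - ent p S) / 2 := by
  have s := ent_submodular (prodw_mem hf hp).1 (J := fun ω => (ω.1 + P ω.2, Z ω.2, S ω.2))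
    (A := fun ω => (ω.1 + P ω.2, S ω.2)) (B := fun ω => (Z ω.2, S ω.2)) (C := fun ω => S ω.2)
    (by simp) (by simp) (by simp only [Prod.mk.injEq]; tauto)
  rw [ent_prodw_snd hf.2, ent_prodw_snd hf.2 p (fun ω => (Z ω, S ω))] at s
  rw [cdist, cdist]
  linarith

/-- If `A`, `B`, `A'`, `B'` are independent with sum `S`, then the distance to `A + B` given `S`
is controlled by the distance to `A`. -/
lemma cdist_add_le {f : G → ℝ} {p : Ω → ℝ} (hf : f ∈ stdSimplex ℝ G) (hp : p ∈ stdSimplex ℝ Ω)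
    (A B A' B' S : Ω → G) (hS : ∀ ω, S ω = A ω + B ω + (A' ω + B' ω))
    (h : ent p A + ent p B + ent p A' + ent p B' ≤ ent p (fun ω => (A ω, B ω, A' ω, B' ω))) :
    cdist f p (fun ω => A ω + B ω) S ≤ rdist f (law p A) + (ent p (fun ω => A ω + B ω) - ent p A) / 2
      + (ent p S - ent p (fun ω => A' ω + B' ω)) / 2 := by
  have e1 := ent_pair_le hp (J := fun ω => (A ω, B ω)) (A := A) (B := B)
    (by simp only [Prod.mk.injEq]; tauto)
  have e2 := ent_pair_le hp (J := fun ω => (A' ω, B' ω)) (A := A') (B := B')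
    (by simp only [Prod.mk.injEq]; tauto)
  have e3 := ent_pair_le hp (J := fun ω => (A ω, B ω, A' ω, B' ω)) (A := fun ω => (A ω, B ω))
    (B := fun ω => (A' ω, B' ω)) (by simp only [Prod.mk.injEq]; tauto)
  have e4 := ent_submodular hp.1 (J := fun ω => (A ω, B ω, A' ω, B' ω))
    (A := fun ω => (A ω, B ω, A' ω + B' ω)) (B := fun ω => (A' ω, B' ω))
    (C := fun ω => A' ω + B' ω) (by simp only [Prod.mk.injEq]; tauto)
    (by intro ω ω'; simp only [Prod.mk.injEq]; grind) (by simp only [Prod.mk.injEq]; tauto)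
  have e5 := ent_submodular hp.1 (J := fun ω => (A ω, B ω, A' ω + B' ω))
    (A := fun ω => (A ω + B ω, S ω)) (B := fun ω => (A ω, B ω))
    (C := fun ω => A ω + B ω) (by simp only [Prod.mk.injEq]; tauto)
    (by intro ω ω'; simp only [Prod.mk.injEq]; grind)
    (by intro ω ω'; simp only [Prod.mk.injEq, hS]; grind)
  have c1 := cdist_le hf hp (fun ω => A ω + B ω) S
  have c2 := rdist_law_add_le hf hp A B (by linarith)
  linarith

lemma rdist_self_le (h2 : ∀ x : G, x + x = 0) {f g : G → ℝ} (hf : f ∈ stdSimplex ℝ G)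
    (hg : g ∈ stdSimplex ℝ G) : rdist f f ≤ 2 * rdist f g := by
  have hff := prodw_mem hf hf
  have hp := prodw_mem hff hg
  have s := ent_submodular hp.1 (J := fun ω => ω) (A := fun ω => ω.1)
    (B := fun ω => (ω.1.1 + ω.2, ω.1.2 + ω.2)) (C := fun ω => ω.1.1 + ω.1.2)
    (by intro ω ω' h; rw [h])
    (by
      intro ω ω'
      have := h2 ω.2
      have := h2 ω'.2
      simp only [Prod.mk.injEq]
      grind)
    (by rintro ⟨x, y⟩ ⟨x', y'⟩; simp only [Prod.mk.injEq]; grind)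
  have s1 := ent_pair_le hp (J := fun ω => (ω.1.1 + ω.2, ω.1.2 + ω.2))
    (A := fun ω => ω.1.1 + ω.2) (B := fun ω => ω.1.2 + ω.2) (by simp only [Prod.mk.injEq]; tauto)
  have m1 := ent_prodw_map (prodw f f) g (fun ω => ω.1) (fun y => y) (fun ω => ω.1 + ω.2)
  have m2 := ent_prodw_map (prodw f f) g (fun ω => ω.2) (fun y => y) (fun ω => ω.1 + ω.2)
  rw [law_prodw_fst f hf.2 (fun x => x), law_id, law_id] at m1
  rw [law_prodw_snd hf.2 f (fun x => x), law_id, law_id] at m2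
  have m3 := ent_prodw hff hg (fun x => x) (fun x => x)
  have m4 := ent_prodw hf hf (fun x => x) (fun x => x)
  rw [ent_prodw_fst _ hg.2 (fun x => x), ent_prodw_fst _ hg.2 (fun x : G × G => x.1 + x.2)] at s
  rw [rdist, rdist]
  simp only at *
  linarith

lemma ent_le_ent_add {f g : G → ℝ} (hf : f ∈ stdSimplex ℝ G) (hg : g ∈ stdSimplex ℝ G) :
    ent f (fun x => x) ≤ ent (prodw f g) (fun ω => ω.1 + ω.2) := by
  have s := ent_pair_le (prodw_mem hf hg) (J := fun ω => (ω.1, ω.2)) (A := fun ω => ω.1 + ω.2)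
    (B := fun ω => ω.2) (by intro ω ω'; simp only [Prod.mk.injEq]; grind)
  rw [ent_prodw hf hg (fun x => x) (fun x => x), ent_prodw_snd hf.2 g (fun x => x)] at s
  linarith

lemma rdist_nonneg {f g : G → ℝ} (hf : f ∈ stdSimplex ℝ G) (hg : g ∈ stdSimplex ℝ G) :
    0 ≤ rdist f g := by
  have a1 := ent_le_ent_add hf hg
  have a2 := ent_le_ent_add hg hf
  have a3 := rdist_comm f g
  simp only [rdist] at a3 ⊢
  linarith

variable {f₀ : G → ℝ} {T η : ℝ}

lemma le_of_prodw (hη : 0 ≤ η) (hf₀ : f₀ ∈ stdSimplex ℝ G)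
    (hmin : ∀ g ∈ stdSimplex ℝ G, ∀ h ∈ stdSimplex ℝ G,
      T ≤ rdist g h + η * (rdist f₀ g + rdist f₀ h))
    {p : Ω → ℝ} {q : Ω' → ℝ} (hp : p ∈ stdSimplex ℝ Ω) (hq : q ∈ stdSimplex ℝ Ω')
    (P : Ω → G) (Q : Ω' → G) (Z : Ω → ζ) (W : Ω' → ξ) :
    T ≤ ent (prodw p q) (fun ω => (P ω.1 + Q ω.2, (Z ω.1, W ω.2))) - ent p Z - ent q W
      - ((ent p (fun ω => (P ω, Z ω)) - ent p Z) + (ent q (fun ω => (Q ω, W ω)) - ent q W)) / 2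
      + η * (cdist f₀ p P Z + cdist f₀ q Q W) := by
  have hpq := prodw_mem hp hq
  have key := le_sum_law_mul hpq (fun ω => (Z ω.1, W ω.2)) (T := T)
    (φ := fun z => rdist (law (condw p Z z.1) P) (law (condw q W z.2) Q)
      + η * (rdist f₀ (law (condw p Z z.1) P) + rdist f₀ (law (condw q W z.2) Q))) (by
    rintro ⟨z, w⟩ hz
    rw [law_prodw] at hz
    exact hmin _ (law_mem (condw_mem hp.1 (left_ne_zero_of_mul hz)) _)
      _ (law_mem (condw_mem hq.1 (right_ne_zero_of_mul hz)) _))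
  have c1 := sum_law_mul_ent_condw hpq.1 (fun ω => (Z ω.1, W ω.2)) (fun ω => P ω.1 + Q ω.2)
  have hlaw : law (prodw p q) (fun ω => (Z ω.1, W ω.2)) = prodw (law p Z) (law q W) := by
    funext ω; rw [law_prodw, prodw]
  rw [hlaw] at c1 key
  have hZ := law_mem hp Z
  have hW := law_mem hq W
  have c2 := sum_law_mul_ent_condw hp.1 Z P
  have c3 := sum_law_mul_ent_condw hq.1 W Q
  have c4 := sum_law_mul_rdist hf₀ hp P Z
  have c5 := sum_law_mul_rdist hf₀ hq Q W
  rw [← sum_prodw_fst _ hW.2] at c2 c4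
  rw [← sum_prodw_snd hZ.2] at c3 c5
  rw [ent_prodw hp hq] at c1
  refine key.trans (le_of_eq ?_)
  have : ent (prodw p q) (fun ω => (P ω.1 + Q ω.2, (Z ω.1, W ω.2))) - ent p Z - ent q W =
    ent (prodw p q) (fun ω => (P ω.1 + Q ω.2, (Z ω.1, W ω.2))) - (ent p Z + ent q W) := by ring
  rw [this, ← c1, ← c2, ← c3, ← c4, ← c5, ← sum_add_distrib, sum_div, ← sum_sub_distrib,
    ← sum_add_distrib, mul_sum, ← sum_add_distrib]
  refine sum_congr rfl fun z _ => ?_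
  rw [rdist_law, ← condw_prodw]
  ring

/-- The fibring inequality for near-minimizers. -/
lemma condMutualInfo_le (hη : 0 ≤ η) (hf₀ : f₀ ∈ stdSimplex ℝ G)
    (hmin : ∀ g ∈ stdSimplex ℝ G, ∀ h ∈ stdSimplex ℝ G,
      T ≤ rdist g h + η * (rdist f₀ g + rdist f₀ h))
    {a c b e : G → ℝ} (ha : a ∈ stdSimplex ℝ G) (hc : c ∈ stdSimplex ℝ G)
    (hb : b ∈ stdSimplex ℝ G) (he : e ∈ stdSimplex ℝ G) {μ : (G × G) × (G × G) → ℝ}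
    (hμ : μ = prodw (prodw a c) (prodw b e)) {S : (G × G) × (G × G) → G}
    (hS : ∀ ω, S ω = ω.1.1 + ω.1.2 + (ω.2.1 + ω.2.2)) :
    ent μ (fun ω => (ω.1.1 + ω.2.1, S ω)) + ent μ (fun ω => (ω.1.1 + ω.1.2, S ω))
      - ent μ (fun ω => (ω.1.1 + ω.2.1, ω.1.1 + ω.1.2, S ω)) - ent μ S ≤
    rdist a b + rdist c e - 2 * T + 2 * η * (rdist f₀ a + rdist f₀ b)
      + η * (rdist a c + rdist b e) := by
  have hac := prodw_mem ha hc
  have hbe := prodw_mem hb he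
  have hp : μ ∈ _ := hμ ▸ prodw_mem hac hbe
  have m1 := le_of_prodw hη hf₀ hmin hac hbe (fun ω => ω.1 + ω.2) (fun ω => ω.1 + ω.2)
    (fun _ => ()) (fun _ => ())
  have m2 := le_of_prodw hη hf₀ hmin hac hbe (fun ω => ω.1) (fun ω => ω.1)
    (fun ω => ω.1 + ω.2) (fun ω => ω.1 + ω.2)
  rw [← hμ] at m1 m2
  rw [ent_const hac, ent_const hbe, ← rdist_law_eq_cdist hf₀ hac, ← rdist_law_eq_cdist hf₀ hbe] at m1
  have pair : ∀ {p q : G → ℝ}, p ∈ stdSimplex ℝ G → q ∈ stdSimplex ℝ G →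
      ent (prodw p q) (fun ω => (ω.1, ω.2)) = ent p (fun x => x) + ent q (fun x => x) :=
    fun hp hq => ent_prodw hp hq (fun x => x) (fun x => x)
  have f1 : ∀ {p q : G → ℝ}, p ∈ stdSimplex ℝ G → q ∈ stdSimplex ℝ G →
      rdist f₀ (law (prodw p q) (fun ω => ω.1 + ω.2)) ≤
      rdist f₀ p + (ent (prodw p q) (fun ω => ω.1 + ω.2) - ent p (fun x => x)) / 2 := by
    intro p q hp hq
    have := rdist_law_add_le hf₀ (prodw_mem hp hq) (fun ω => ω.1) (fun ω => ω.2) (by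
      rw [pair hp hq, ent_prodw_fst _ hq.2 (fun x => x), ent_prodw_snd hp.2 _ (fun x => x)])
    rwa [law_prodw_fst _ hq.2 (fun x => x), ent_prodw_fst _ hq.2 (fun x => x), law_id] at this
  have f3 : ∀ {p q : G → ℝ}, p ∈ stdSimplex ℝ G → q ∈ stdSimplex ℝ G →
      ent (prodw p q) (fun ω => (ω.1, ω.1 + ω.2)) = ent p (fun x => x) + ent q (fun x => x) := by
    intro p q hp hq
    rw [← pair hp hq]
    exact ent_congr _ fun ω ω' => by simp only [Prod.mk.injEq]; grind
  have f2 : ∀ {p q : G → ℝ}, p ∈ stdSimplex ℝ G → q ∈ stdSimplex ℝ G →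
      cdist f₀ (prodw p q) (fun ω => ω.1) (fun ω => ω.1 + ω.2) ≤
      rdist f₀ p + (ent (prodw p q) (fun ω => ω.1 + ω.2) - ent q (fun x => x)) / 2 := by
    intro p q hp hq
    have := cdist_le hf₀ (prodw_mem hp hq) (fun ω => ω.1) (fun ω => ω.1 + ω.2)
    rw [law_prodw_fst _ hq.2 (fun x => x), ent_prodw_fst _ hq.2 (fun x => x), law_id,
      f3 hp hq] at this
    linarith
  have g1 := mul_le_mul_of_nonneg_left (add_le_add (f1 ha hc) (f1 hb he)) hη
  have g2 := mul_le_mul_of_nonneg_left (add_le_add (f2 ha hc) (f2 hb he)) hη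
  rw [f3 ha hc, f3 hb he] at m2
  have d1 : ∀ {p q : G → ℝ}, ent (prodw p q) (fun ω => (ω.1 + ω.2, ())) =
      ent (prodw p q) (fun ω => ω.1 + ω.2) := ent_congr _ (by simp)
  have d2 : ent μ (fun ω => (ω.1.1 + ω.1.2 + (ω.2.1 + ω.2.2), (), ())) = ent μ S :=
    ent_congr _ (by simp [hS])
  have d3 : ent μ (fun ω => (ω.1.1 + ω.2.1, ω.1.1 + ω.1.2, ω.2.1 + ω.2.2)) =
      ent μ (fun ω => (ω.1.1 + ω.2.1, ω.1.1 + ω.1.2, S ω)) :=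
    ent_congr _ fun ω ω' => by simp only [Prod.mk.injEq, hS]; grind
  rw [d1, d1, d2] at m1
  rw [d3] at m2
  have u1 := ent_pair_le hp (J := fun ω => (ω.1.1 + ω.2.1, S ω)) (A := fun ω => ω.1.1 + ω.2.1)
    (B := fun ω => ω.1.2 + ω.2.2) (by intro ω ω'; simp only [Prod.mk.injEq, hS]; grind)
  have u2 := ent_pair_le hp (J := fun ω => (ω.1.1 + ω.1.2, S ω)) (A := fun ω => ω.1.1 + ω.1.2)
    (B := fun ω => ω.2.1 + ω.2.2) (by intro ω ω'; simp only [Prod.mk.injEq, hS]; grind)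
  rw [hμ, ent_prodw_fst _ hbe.2 (fun x : G × G => x.1 + x.2),
    ent_prodw_snd hac.2 _ (fun x : G × G => x.1 + x.2), ← hμ] at u2
  have v1 := ent_prodw_map (prodw a c) (prodw b e) (fun ω => ω.1) (fun ω => ω.1)
    (fun ω => ω.1 + ω.2)
  have v2 := ent_prodw_map (prodw a c) (prodw b e) (fun ω => ω.2) (fun ω => ω.2)
    (fun ω => ω.1 + ω.2)
  rw [law_prodw_fst _ hc.2 (fun x => x), law_prodw_fst _ he.2 (fun x => x), law_id, law_id,
    ← hμ] at v1
  rw [law_prodw_snd ha.2 _ (fun x => x), law_prodw_snd hb.2 _ (fun x => x), law_id, law_id,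
    ← hμ] at v2
  simp only [rdist] at *
  linarith

/-- The inequality obtained by testing minimality on the pair provided by the entropic
Balog–Szemerédi–Gowers lemma. -/
lemma le_of_add_eq (hη : 0 ≤ η) (h2 : ∀ x : G, x + x = 0) (hf₀ : f₀ ∈ stdSimplex ℝ G)
    (hmin : ∀ g ∈ stdSimplex ℝ G, ∀ h ∈ stdSimplex ℝ G,
      T ≤ rdist g h + η * (rdist f₀ g + rdist f₀ h))
    {p : Ω → ℝ} (hp : p ∈ stdSimplex ℝ Ω) (A B C : Ω → G) (S : Ω → σ)
    (hC : ∀ ω, C ω = A ω + B ω) {J : ℝ} (hJ : ent p (fun ω => (A ω, B ω, S ω)) = J) :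
    T ≤ 2 * (ent p (fun ω => (A ω, S ω)) + ent p (fun ω => (B ω, S ω))) - 3 * J - 3 * ent p S
      + 2 * ent p (fun ω => (C ω, S ω)) + η * (cdist f₀ p A S + cdist f₀ p B S
        + (ent p (fun ω => (A ω, S ω)) + ent p (fun ω => (B ω, S ω))
          + 2 * ent p (fun ω => (C ω, S ω)) - 2 * J - 2 * ent p S) / 2) := by
  obtain rfl : C = fun ω => A ω + B ω := funext hC
  have key := le_sum_law_mul hp (fun ω => (A ω + B ω, S ω)) fun z hz =>
    hmin _ (law_mem (condw_mem hp.1 hz) A) _ (law_mem (condw_mem hp.1 hz) B)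
  have b := sum_rdist_condw_le h2 hp A B S
  have s1 := sum_law_mul_rdist hf₀ hp A (fun ω => (A ω + B ω, S ω))
  have s2 := sum_law_mul_rdist hf₀ hp B (fun ω => (A ω + B ω, S ω))
  have c1 := cdist_pair_le hf₀ hp A (fun ω => A ω + B ω) S
  have c2 := cdist_pair_le hf₀ hp B (fun ω => A ω + B ω) S
  have e1 : ent p (fun ω => (A ω, A ω + B ω, S ω)) = J := by
    rw [← hJ]; exact ent_congr p fun ω ω' => by simp only [Prod.mk.injEq]; grind
  have e2 : ent p (fun ω => (B ω, A ω + B ω, S ω)) = J := by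
    rw [← hJ]; exact ent_congr p fun ω ω' => by simp only [Prod.mk.injEq]; grind
  rw [e1] at c1
  rw [e2] at c2
  rw [hJ] at b
  have g := mul_le_mul_of_nonneg_left (add_le_add c1 c2) hη
  simp only [mul_add, mul_left_comm _ η, sum_add_distrib, ← mul_sum] at key
  rw [s1, s2] at key
  linarith

end Minimizer

/-! ### Vanishing of the distance at a minimizer -/

section Vanishing

open Real Finset

variable {Ω G : Type*} [Fintype Ω] [AddCommGroup G] [Fintype G]

lemma cdist_sum_le {f₀ : G → ℝ} (hf₀ : f₀ ∈ stdSimplex ℝ G) {p : Ω → ℝ} (hp : p ∈ stdSimplex ℝ Ω)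
    (h2 : ∀ x : G, x + x = 0) (A B A' B' S : Ω → G) (hS : ∀ ω, S ω = A ω + B ω + (A' ω + B' ω))
    (h : ent p A + ent p B + ent p A' + ent p B' ≤ ent p (fun ω => (A ω, B ω, A' ω, B' ω))) :
    2 * cdist f₀ p (fun ω => A ω + B ω) S ≤
      rdist f₀ (law p A) + rdist f₀ (law p A') - (ent p A + ent p A') / 2 + ent p S := by
  have c1 := cdist_add_le hf₀ hp A B A' B' S hS h
  have c2 := cdist_add_le hf₀ hp A' B' A B S (fun ω => by rw [hS]; abel) (by
    have : ent p (fun ω => (A' ω, B' ω, A ω, B ω)) = ent p (fun ω => (A ω, B ω, A' ω, B' ω)) :=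
      ent_congr p fun ω ω' => by simp only [Prod.mk.injEq]; tauto
    linarith)
  have c3 : cdist f₀ p (fun ω => A' ω + B' ω) S = cdist f₀ p (fun ω => A ω + B ω) S := by
    rw [cdist, cdist]
    have e1 : ent (prodw f₀ p) (fun ω => (ω.1 + (A' ω.2 + B' ω.2), S ω.2)) =
        ent (prodw f₀ p) (fun ω => (ω.1 + (A ω.2 + B ω.2), S ω.2)) :=
      ent_congr _ fun ω ω' => by
        have := h2 (A ω.2 + B ω.2)
        have := h2 (A ω'.2 + B ω'.2)
        have := h2 (A' ω.2 + B' ω.2)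
        have := h2 (A' ω'.2 + B' ω'.2)
        simp only [Prod.mk.injEq, hS]
        grind
    have e2 : ent p (fun ω => (A' ω + B' ω, S ω)) = ent p (fun ω => (A ω + B ω, S ω)) :=
      ent_congr _ fun ω ω' => by simp only [Prod.mk.injEq, hS]; grind
    rw [e1, e2]
  linarith

theorem rdist_eq_zero_of_isMin (h2 : ∀ x : G, x + x = 0) {f₀ f g : G → ℝ}
    (hf₀ : f₀ ∈ stdSimplex ℝ G) (hf : f ∈ stdSimplex ℝ G) (hg : g ∈ stdSimplex ℝ G)
    (hmin : ∀ f' ∈ stdSimplex ℝ G, ∀ g' ∈ stdSimplex ℝ G,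
      rdist f g + 1 / 15 * (rdist f₀ f + rdist f₀ g) ≤
        rdist f' g' + 1 / 15 * (rdist f₀ f' + rdist f₀ g')) :
    rdist f g = 0 := by
  have hff := prodw_mem hf hf
  have hgg := prodw_mem hg hg
  have hμ := prodw_mem hff hgg
  set μ : (G × G) × (G × G) → ℝ := prodw (prodw f f) (prodw g g) with hμd
  let e : (G × G) × (G × G) ≃ (G × G) × (G × G) :=
    { toFun := fun ω => ((ω.1.1, ω.2.2), (ω.2.1, ω.1.2))
      invFun := fun ω => ((ω.1.1, ω.2.2), (ω.2.1, ω.1.2))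
      left_inv := fun _ => rfl
      right_inv := fun _ => rfl }
  let e' : (G × G) × (G × G) ≃ (G × G) × (G × G) :=
    { toFun := fun ω => ((ω.1.2, ω.1.1), ω.2)
      invFun := fun ω => ((ω.1.2, ω.1.1), ω.2)
      left_inv := fun _ => rfl
      right_inv := fun _ => rfl }
  have he : (fun ω => prodw (prodw f g) (prodw g f) (e ω)) = μ := by
    funext ω; simp only [e, hμd, prodw, Equiv.coe_fn_mk]; ring
  have he' : (fun ω => μ (e' ω)) = μ := by
    funext ω; simp only [e', hμd, prodw, Equiv.coe_fn_mk]; ring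
  let S : (G × G) × (G × G) → G := fun ω => ω.1.1 + ω.1.2 + (ω.2.1 + ω.2.2)
  have hff0 : rdist f f ≤ 2 * rdist f g := rdist_self_le h2 hf hg
  have hgg0 : rdist g g ≤ 2 * rdist f g := rdist_comm f g ▸ rdist_self_le h2 hg hf
  have hk := rdist_nonneg hf hg
  have hη : (0 : ℝ) ≤ 1 / 15 := by norm_num
  -- the joint entropies
  have jUW : ent μ (fun ω => (ω.1.1 + ω.2.1, ω.1.1 + ω.1.2, S ω)) =
      ent μ (fun ω => (ω.1.1 + ω.2.1, ω.1.2 + ω.2.1, S ω)) := ent_congr μ fun ω ω' => by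
    have := h2 ω.2.1
    have := h2 ω'.2.1
    have := h2 ω.1.1
    have := h2 ω'.1.1
    simp only [Prod.mk.injEq]
    grind
  have jVW : ent μ (fun ω => (ω.1.2 + ω.2.1, ω.1.1 + ω.1.2, S ω)) =
      ent μ (fun ω => (ω.1.1 + ω.2.1, ω.1.2 + ω.2.1, S ω)) := ent_congr μ fun ω ω' => by
    have := h2 ω.2.1
    have := h2 ω'.2.1
    have := h2 ω.1.2
    have := h2 ω'.1.2
    simp only [Prod.mk.injEq]
    grind
  have jV : ent μ (fun ω => (ω.1.2 + ω.2.1, S ω)) = ent μ (fun ω => (ω.1.1 + ω.2.1, S ω)) := by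
    have := ent_comp_equiv μ e' fun ω => (ω.1.1 + ω.2.1, S ω)
    rw [he'] at this
    rw [← this]
    exact ent_congr μ fun ω ω' => by
      simp only [Prod.mk.injEq, e', Equiv.coe_fn_mk, S, add_comm ω.1.2 ω.1.1,
        add_comm ω'.1.2 ω'.1.1]
  have i1 := condMutualInfo_le hη hf₀ hmin hf hf hg hg hμd (S := S) fun _ => rfl
  have i2 := condMutualInfo_le hη hf₀ hmin hf hg hg hf rfl
    (S := fun ω => ω.1.1 + ω.2.2 + (ω.2.1 + ω.1.2)) fun _ => by abel
  simp only [← ent_comp_equiv (prodw (prodw f g) (prodw g f)) e, he] at i2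
  simp only [e, Equiv.coe_fn_mk] at i2
  have kV : ent μ (fun ω => (ω.1.1 + ω.2.2, S ω)) = ent μ (fun ω => (ω.1.2 + ω.2.1, S ω)) :=
    ent_congr μ fun ω ω' => by simp only [Prod.mk.injEq, S]; grind
  have kUV : ent μ (fun ω => (ω.1.1 + ω.2.1, ω.1.1 + ω.2.2, S ω)) =
      ent μ (fun ω => (ω.1.1 + ω.2.1, ω.1.2 + ω.2.1, S ω)) :=
    ent_congr μ fun ω ω' => by simp only [Prod.mk.injEq, S]; grind
  change ent μ (fun ω => (ω.1.1 + ω.2.1, S ω)) + ent μ (fun ω => (ω.1.1 + ω.2.2, S ω))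
    - ent μ (fun ω => (ω.1.1 + ω.2.1, ω.1.1 + ω.2.2, S ω)) - ent μ S ≤ _ at i2
  rw [kV, kUV, rdist_comm g f] at i2
  rw [jUW] at i1
  have t1 := le_of_add_eq hη h2 hf₀ hmin hμ (fun ω => ω.1.1 + ω.2.1) (fun ω => ω.1.2 + ω.2.1)
    (fun ω => ω.1.1 + ω.1.2) S (fun ω => by have := h2 ω.2.1; grind) rfl
  have t2 := le_of_add_eq hη h2 hf₀ hmin hμ (fun ω => ω.1.1 + ω.2.1) (fun ω => ω.1.1 + ω.1.2)
    (fun ω => ω.1.2 + ω.2.1) S (fun ω => by have := h2 ω.1.1; grind) jUW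
  have t3 := le_of_add_eq hη h2 hf₀ hmin hμ (fun ω => ω.1.2 + ω.2.1) (fun ω => ω.1.1 + ω.1.2)
    (fun ω => ω.1.1 + ω.2.1) S (fun ω => by have := h2 ω.1.2; grind) jVW
  -- laws and entropies of the coordinates
  have l1 : law μ (fun ω => ω.1.1) = f := by
    rw [hμd, law_prodw_fst _ hgg.2 (fun x : G × G => x.1), law_prodw_fst _ hf.2 (fun x => x), law_id]
  have l2 : law μ (fun ω => ω.1.2) = f := by
    rw [hμd, law_prodw_fst _ hgg.2 (fun x : G × G => x.2), law_prodw_snd hf.2 _ (fun x => x), law_id]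
  have l3 : law μ (fun ω => ω.2.1) = g := by
    rw [hμd, law_prodw_snd hff.2 _ (fun x : G × G => x.1), law_prodw_fst _ hg.2 (fun x => x), law_id]
  have l4 : law μ (fun ω => ω.2.2) = g := by
    rw [hμd, law_prodw_snd hff.2 _ (fun x : G × G => x.2), law_prodw_snd hg.2 _ (fun x => x), law_id]
  have E1 : ent μ (fun ω => ω.1.1) = ent f (fun x => x) := by
    rw [← ent_law μ (fun ω => ω.1.1) (fun x => x), l1]
  have E2 : ent μ (fun ω => ω.1.2) = ent f (fun x => x) := by
    rw [← ent_law μ (fun ω => ω.1.2) (fun x => x), l2]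
  have E3 : ent μ (fun ω => ω.2.1) = ent g (fun x => x) := by
    rw [← ent_law μ (fun ω => ω.2.1) (fun x => x), l3]
  have E4 : ent μ (fun ω => ω.2.2) = ent g (fun x => x) := by
    rw [← ent_law μ (fun ω => ω.2.2) (fun x => x), l4]
  have full : ent μ (fun ω => (ω.1, ω.2)) =
      2 * ent f (fun x => x) + 2 * ent g (fun x => x) := by
    rw [hμd, ent_prodw hff hgg (fun x => x) (fun x => x), ent_prodw hf hf (fun x => x) (fun x => x),
      ent_prodw hg hg (fun x => x) (fun x => x)]
    ring
  have P1 : ent μ (fun ω => (ω.1.1, ω.2.1, ω.2.2, ω.1.2)) = ent μ (fun ω => (ω.1, ω.2)) :=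
    ent_congr μ fun ω ω' => by simp only [Prod.ext_iff]; tauto
  have P2 : ent μ (fun ω => (ω.1.2, ω.2.1, ω.2.2, ω.1.1)) = ent μ (fun ω => (ω.1, ω.2)) :=
    ent_congr μ fun ω ω' => by simp only [Prod.ext_iff]; tauto
  have P3 : ent μ (fun ω => (ω.1.1, ω.1.2, ω.2.1, ω.2.2)) = ent μ (fun ω => (ω.1, ω.2)) :=
    ent_congr μ fun ω ω' => by simp only [Prod.ext_iff]; tauto
  have c1 := cdist_sum_le hf₀ hμ h2 (fun ω => ω.1.1) (fun ω => ω.2.1) (fun ω => ω.2.2)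
    (fun ω => ω.1.2) S (fun _ => by simp only [S]; abel) (by rw [P1, E1, E2, E3, E4, full]; linarith)
  have c2 := cdist_sum_le hf₀ hμ h2 (fun ω => ω.1.2) (fun ω => ω.2.1) (fun ω => ω.2.2)
    (fun ω => ω.1.1) S (fun _ => by simp only [S]; abel) (by rw [P2, E1, E2, E3, E4, full]; linarith)
  have c3 := cdist_sum_le hf₀ hμ h2 (fun ω => ω.1.1) (fun ω => ω.1.2) (fun ω => ω.2.1)
    (fun ω => ω.2.2) S (fun _ => rfl) (by rw [P3, E1, E2, E3, E4, full]; linarith)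
  simp only [l1, l2, l3, l4, E1, E2, E3, E4] at c1 c2 c3
  -- the entropy of the total sum
  have q : ∀ (φ ψ : G × G → G), law (prodw f f) φ = f → law (prodw g g) ψ = g →
      ent μ (fun ω => φ ω.1 + ψ ω.2) = ent (prodw f g) (fun ω => ω.1 + ω.2) := by
    intro φ ψ h1 h2
    have := ent_prodw_map (prodw f f) (prodw g g) φ ψ (fun ω => ω.1 + ω.2)
    rwa [h1, h2] at this
  have f1 : law (prodw f f) (fun ω => ω.1) = f := by
    rw [law_prodw_fst _ hf.2 (fun x => x), law_id]
  have f2 : law (prodw f f) (fun ω => ω.2) = f := by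
    rw [law_prodw_snd hf.2 _ (fun x => x), law_id]
  have g1 : law (prodw g g) (fun ω => ω.1) = g := by
    rw [law_prodw_fst _ hg.2 (fun x => x), law_id]
  have g2 : law (prodw g g) (fun ω => ω.2) = g := by
    rw [law_prodw_snd hg.2 _ (fun x => x), law_id]
  have s1 := ent_add_add_le hμ (fun ω => ω.1.1) (fun ω => ω.2.2) (fun ω => ω.1.2 + ω.2.1) (by
    have a1 := ent_submodular hμ.1 (J := fun ω => (ω.1, ω.2))
      (A := fun ω => (ω.1.1, ω.2.2, ω.1.2 + ω.2.1)) (B := fun ω => (ω.1.2, ω.2.1))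
      (C := fun ω => ω.1.2 + ω.2.1)
      (by intro ω ω'; simp only [Prod.mk.injEq]; tauto)
      (by intro ω ω'; simp only [Prod.mk.injEq]; grind)
      (by intro ω ω'; simp only [Prod.ext_iff]; tauto)
    have a2 := ent_pair_le hμ (J := fun ω => (ω.1.2, ω.2.1))
      (A := fun ω => ω.1.2) (B := fun ω => ω.2.1) (by simp only [Prod.mk.injEq]; tauto)
    linarith)
  have s2 := ent_add_add_le hμ (fun ω => ω.2.2) (fun ω => ω.1.2) (fun ω => ω.2.1) (by
    have a1 := ent_pair_le hμ (J := fun ω => (ω.1, ω.2))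
      (A := fun ω => (ω.2.2, ω.1.2, ω.2.1)) (B := fun ω => ω.1.1)
      (by intro ω ω'; simp only [Prod.ext_iff]; tauto)
    linarith)
  have s3 : ent μ (fun ω => ω.1.1 + ω.2.2 + (ω.1.2 + ω.2.1)) = ent μ S :=
    ent_congr μ fun ω ω' => by simp only [S]; grind
  have s4 : ent μ (fun ω => ω.2.2 + (ω.1.2 + ω.2.1)) = ent μ (fun ω => ω.2.2 + ω.1.2 + ω.2.1) :=
    ent_congr μ fun ω ω' => by grind
  have s5 : ent μ (fun ω => ω.2.2 + ω.1.2) = ent μ (fun ω => ω.1.2 + ω.2.2) :=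
    ent_congr μ fun ω ω' => by grind
  rw [s3, s4, E4, q _ _ f1 g2] at s1
  rw [s5, E2, q _ _ f2 g2, q _ _ f2 g1] at s2
  have hk' : rdist f g = ent (prodw f g) (fun ω => ω.1 + ω.2)
    - (ent f (fun x => x) + ent g (fun x => x)) / 2 := rfl
  refine le_antisymm ?_ hk
  linarith

end Vanishing

/-! ### Existence and structure of minimizers -/

section Structure

open Real Finset

variable {Ω G : Type*} [Fintype Ω] [AddCommGroup G] [Fintype G]

lemma continuous_ent {α κ : Type*} [Fintype α] [TopologicalSpace κ] {p : κ → Ω → ℝ}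
    (hp : Continuous p) (X : Ω → α) : Continuous fun k => ent (p k) X := by
  simp only [ent_eq_sum_negMulLog]
  refine continuous_finsetSum _ fun a _ => continuous_negMulLog.comp ?_
  refine continuous_finsetSum _ fun ω _ => ?_
  split_ifs
  · exact (continuous_apply ω).comp hp
  · exact continuous_const

lemma continuous_rdist {κ : Type*} [TopologicalSpace κ] {f g : κ → G → ℝ}
    (hf : Continuous f) (hg : Continuous g) : Continuous fun k => rdist (f k) (g k) := by
  have hfg : Continuous fun k => prodw (f k) (g k) := continuous_pi fun ω =>
    ((continuous_apply ω.1).comp hf).mul ((continuous_apply ω.2).comp hg)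
  exact (continuous_ent hfg _).sub (((continuous_ent hf _).add (continuous_ent hg _)).div_const 2)

lemma exists_isMin {f₀ : G → ℝ} (hf₀ : f₀ ∈ stdSimplex ℝ G) (η : ℝ) :
    ∃ f ∈ stdSimplex ℝ G, ∃ g ∈ stdSimplex ℝ G, ∀ f' ∈ stdSimplex ℝ G, ∀ g' ∈ stdSimplex ℝ G,
      rdist f g + η * (rdist f₀ f + rdist f₀ g) ≤
        rdist f' g' + η * (rdist f₀ f' + rdist f₀ g') := by
  have hc : Continuous fun x : (G → ℝ) × (G → ℝ) =>
      rdist x.1 x.2 + η * (rdist f₀ x.1 + rdist f₀ x.2) :=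
    (continuous_rdist continuous_fst continuous_snd).add
      (((continuous_rdist continuous_const continuous_fst).add
        (continuous_rdist continuous_const continuous_snd)).const_mul η)
  obtain ⟨⟨f, g⟩, ⟨hf, hg⟩, h⟩ := ((isCompact_stdSimplex ℝ G).prod
    (isCompact_stdSimplex ℝ G)).exists_isMinOn ⟨(f₀, f₀), hf₀, hf₀⟩ hc.continuousOn
  exact ⟨f, hf, g, hg, fun f' hf' g' hg' => h (⟨hf', hg'⟩ : (f', g') ∈ _ ×ˢ _)⟩

lemma law_add_eq (h2 : ∀ x : G, x + x = 0) (f g : G → ℝ) (s : G) :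
    law (prodw f g) (fun ω => ω.1 + ω.2) s = ∑ y, g y * f (s + y) := by
  simp only [law, prodw, Fintype.sum_prod_type_right]
  refine sum_congr rfl fun y _ => ?_
  rw [sum_eq_single (s + y)]
  · rw [if_pos (by have := h2 y; grind), mul_comm]
  · intro x _ hx
    exact if_neg fun h => hx (by have := h2 y; grind)
  · simp

/-- If adding an independent variable does not increase the entropy, then the law is invariant
under differences of the support. -/
lemma apply_add_eq_of_ent_add_le (h2 : ∀ x : G, x + x = 0) {f g : G → ℝ}
    (hf : f ∈ stdSimplex ℝ G) (hg : g ∈ stdSimplex ℝ G)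
    (h : ent (prodw f g) (fun ω => ω.1 + ω.2) ≤ ent f (fun x => x)) {y y' : G} (hy : g y ≠ 0)
    (hy' : g y' ≠ 0) (x : G) : f (x + (y + y')) = f x := by
  set m := law (prodw f g) (fun ω => ω.1 + ω.2) with hm
  have hms : ∀ s, m s = ∑ y, g y • f (s + y) := law_add_eq h2 f g
  have jensen : ∀ s, ∑ y, g y • negMulLog (f (s + y)) ≤ negMulLog (m s) := fun s => by
    rw [hms]
    exact strictConcaveOn_negMulLog.concaveOn.le_map_sum (fun y _ => hg.1 y) hg.2
      fun y _ => hf.1 _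
  have total : ∑ s, ∑ y, g y • negMulLog (f (s + y)) = ent f (fun x => x) := by
    rw [sum_comm, ent_eq_sum_negMulLog, law_id]
    simp only [smul_eq_mul, ← mul_sum]
    have : ∀ y, ∑ s, negMulLog (f (s + y)) = ∑ s, negMulLog (f s) := fun y =>
      _root_.Equiv.sum_comp (Equiv.addRight y) fun s => negMulLog (f s)
    simp only [this, ← sum_mul, hg.2, one_mul]
  rw [ent_eq_sum_negMulLog, ← total] at h
  have eqs : ∀ s, ∑ y, g y • negMulLog (f (s + y)) = negMulLog (m s) := fun s =>
    (sum_eq_sum_iff_of_le fun s _ => jensen s).1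
      (le_antisymm (sum_le_sum fun s _ => jensen s) h) s (mem_univ s)
  have key : ∀ s y, g y ≠ 0 → f (s + y) = m s := fun s y hy => by
    have := eqs s
    rw [hms, eq_comm, strictConcaveOn_negMulLog.map_sum_eq_iff' (fun y _ => hg.1 y) hg.2
      fun y _ => hf.1 _] at this
    rw [hms]
    exact this y (mem_univ y) hy
  rw [← add_assoc, key _ y' hy', ← key _ y hy, add_assoc, h2, add_zero]

/-- The group of periods of a function. -/
def periods (f : G → ℝ) : AddSubgroup G where
  carrier := {h | ∀ x, f (x + h) = f x}
  zero_mem' := by simp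
  add_mem' := by
    intro a b ha hb x
    rw [← add_assoc, hb, ha]
  neg_mem' := by
    intro a ha x
    rw [← ha, neg_add_cancel_right]

/-- The uniform weight function on a finite set. -/
noncomputable def unif (A : Finset G) (x : G) : ℝ := if x ∈ A then (#A : ℝ)⁻¹ else 0

omit [AddCommGroup G] in
lemma unif_mem {A : Finset G} (hA : A.Nonempty) : unif A ∈ stdSimplex ℝ G := by
  refine ⟨fun x => by unfold unif; positivity, ?_⟩
  have : (#A : ℝ) ≠ 0 := by exact_mod_cast hA.card_pos.ne'
  simp [unif, this]

omit [AddCommGroup G] in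
lemma ent_unif {A : Finset G} (hA : A.Nonempty) : ent (unif A) (fun x => x) = log #A := by
  have : (#A : ℝ) ≠ 0 := by exact_mod_cast hA.card_pos.ne'
  simp only [ent, law_id, unif, ite_mul, zero_mul, sum_ite_mem, univ_inter]
  rw [sum_congr rfl fun x hx => by rw [if_pos hx], sum_const, nsmul_eq_mul, log_inv]
  field_simp

lemma eq_unif {f : G → ℝ} (hf : f ∈ stdSimplex ℝ G) {H : AddSubgroup G} {x₀ : G}
    (hH : H ≤ periods f) (hx : ∀ x, f x ≠ 0 → x - x₀ ∈ H) : f = unif {x | x - x₀ ∈ H} := by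
  have h1 : ∀ x, f x = if x - x₀ ∈ H then f x₀ else 0 := fun x => by
    split_ifs with h
    · rw [← hH h x₀, add_sub_cancel]
    · by_contra h'
      exact h (hx x h')
  have h3 : (#{x | x - x₀ ∈ H} : ℝ) * f x₀ = 1 := by
    rw [← hf.2, sum_congr rfl fun x _ => h1 x, ← sum_filter, sum_const, nsmul_eq_mul]
  funext x
  rw [h1, unif, ← eq_inv_of_mul_eq_one_right h3]
  simp

lemma exists_eq_unif_of_rdist_eq_zero (h2 : ∀ x : G, x + x = 0) {f g : G → ℝ}
    (hf : f ∈ stdSimplex ℝ G) (hg : g ∈ stdSimplex ℝ G) (h : rdist f g = 0) :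
    ∃ (H : AddSubgroup G) (x₀ y₀ : G), f = unif {x | x - x₀ ∈ H} ∧ g = unif {x | x - y₀ ∈ H} := by
  have hsub : ∀ x y : G, x - y = x + y := fun x y => by have := h2 y; grind
  have key : ∀ {f g : G → ℝ}, f ∈ stdSimplex ℝ G → g ∈ stdSimplex ℝ G → rdist f g = 0 →
      ∀ x y, g x ≠ 0 → g y ≠ 0 → x - y ∈ periods f := by
    intro f g hf hg h x y hx hy z
    rw [hsub]
    refine apply_add_eq_of_ent_add_le h2 hf hg ?_ hx hy z
    have a2 := ent_le_ent_add hg hf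
    have a3 := rdist_comm f g
    rw [h, rdist] at a3
    rw [rdist] at h
    linarith
  have key' : ∀ {f g : G → ℝ}, f ∈ stdSimplex ℝ G → g ∈ stdSimplex ℝ G → rdist f g = 0 →
      periods f ≤ periods g := by
    intro f g hf hg h z hz
    obtain ⟨x, -, hx⟩ := exists_ne_zero_of_sum_ne_zero (hf.2 ▸ one_ne_zero : ∑ x, f x ≠ 0)
    have := key hg hf (rdist_comm f g ▸ h) (x + z) x (by rwa [hz]) hx
    rwa [add_sub_cancel_left] at this
  have h' := rdist_comm f g ▸ h
  obtain ⟨x, -, hx⟩ := exists_ne_zero_of_sum_ne_zero (hf.2 ▸ one_ne_zero : ∑ x, f x ≠ 0)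
  obtain ⟨y, -, hy⟩ := exists_ne_zero_of_sum_ne_zero (hg.2 ▸ one_ne_zero : ∑ x, g x ≠ 0)
  exact ⟨periods f, x, y,
    eq_unif hf le_rfl fun z hz => key' hg hf h' (key hg hf h' z x hz hx),
    eq_unif hg (key' hf hg h) fun z hz => key hf hg h z y hz hy⟩

lemma exists_le_of_sum_mul_le {ι : Type*} [Fintype ι] {m φ : ι → ℝ} (hm : m ∈ stdSimplex ℝ ι)
    {T : ℝ} (h : ∑ i, m i * φ i ≤ T) : ∃ i, m i ≠ 0 ∧ φ i ≤ T := by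
  by_contra! hcon
  obtain ⟨i, -, hi⟩ := exists_ne_zero_of_sum_ne_zero (hm.2 ▸ one_ne_zero : ∑ x, m x ≠ 0)
  have hlt : ∑ x, m x * T < ∑ x, m x * φ x := by
    refine sum_lt_sum (fun x _ => ?_) ⟨i, mem_univ i,
      mul_lt_mul_of_pos_left (hcon i hi) ((hm.1 i).lt_of_ne' hi)⟩
    by_cases hx : m x = 0
    · simp [hx]
    · exact mul_le_mul_of_nonneg_left (hcon x hx).le (hm.1 x)
  rw [← sum_mul, hm.2, one_mul] at hlt
  exact h.not_gt hlt

lemma exists_le_card_filter (h2 : ∀ x : G, x + x = 0) {A B : Finset G} (hA : A.Nonempty)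
    (hB : B.Nonempty) :
    ∃ s, exp (-(2 * rdist (unif A) (unif B))) * (#A * #B) ≤ (#{a ∈ A | s + a ∈ B} : ℝ) ^ 2 := by
  have hA' : (0 : ℝ) < #A := by exact_mod_cast hA.card_pos
  have hB' : (0 : ℝ) < #B := by exact_mod_cast hB.card_pos
  have hm := law_mem (prodw_mem (unif_mem hA) (unif_mem hB)) (fun ω => ω.1 + ω.2)
  set m := law (prodw (unif A) (unif B)) (fun ω => ω.1 + ω.2) with hmd
  have hcard : ∀ s, m s = #{a ∈ A | s + a ∈ B} / (#A * #B) := fun s => by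
    have : m s = law (prodw (unif B) (unif A)) (fun ω => ω.1 + ω.2) s := by
      rw [hmd, law_add_eq h2, law_add_eq h2, ← _root_.Equiv.sum_comp (Equiv.addLeft s)]
      refine sum_congr rfl fun x _ => ?_
      have : s + (s + x) = x := by have := h2 s; grind
      simp [this, mul_comm]
    rw [this, law_add_eq h2]
    simp only [unif, ite_mul, mul_ite, zero_mul, mul_zero]
    rw [← sum_filter, ← sum_filter, filter_filter, sum_const, nsmul_eq_mul, div_eq_mul_inv, mul_inv]
    congr 3
    ext a
    simp [and_comm]
  obtain ⟨s, hs, hs'⟩ := exists_le_of_sum_mul_le hm (φ := fun s => -log (m s))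
    (T := ent (prodw (unif A) (unif B)) (fun ω => ω.1 + ω.2)) (by
    rw [ent_eq_sum_negMulLog]
    exact sum_le_sum fun x _ => by rw [← hmd, negMulLog, mul_neg, neg_mul])
  refine ⟨s, ?_⟩
  have hpos : 0 < m s := (hm.1 s).lt_of_ne' hs
  have e1 : (#{a ∈ A | s + a ∈ B} : ℝ) = m s * (#A * #B) := by rw [hcard]; field_simp
  have hrd : rdist (unif A) (unif B) =
    ent (prodw (unif A) (unif B)) (fun ω => ω.1 + ω.2) - (log #A + log #B) / 2 := by
    rw [rdist, ent_unif hA, ent_unif hB]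
  have hAB := mul_pos hA' hB'
  rw [e1, ← log_le_log_iff (mul_pos (exp_pos _) hAB) (pow_pos (mul_pos hpos hAB) 2),
    log_mul (exp_ne_zero _) hAB.ne', log_exp, log_pow, log_mul hs hAB.ne',
    log_mul hA'.ne' hB'.ne', hrd]
  push_cast
  linarith

/-- Marton's conjecture in characteristic two, for sets with small entropic self-distance. -/
theorem exists_subgroup_card_filter (h2 : ∀ x : G, x + x = 0) {A : Finset G} (hA : A.Nonempty) :
    ∃ (H : AddSubgroup G) (t : G),
      exp (-(17 * rdist (unif A) (unif A))) * #A ≤ #{a ∈ A | a + t ∈ H} ∧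
      exp (-(17 * rdist (unif A) (unif A))) * Nat.card H ≤ #{a ∈ A | a + t ∈ H} := by
  have hf₀ := unif_mem hA
  obtain ⟨f, hf, g, hg, hmin⟩ := exists_isMin hf₀ (1 / 15)
  have h0 := rdist_eq_zero_of_isMin h2 hf₀ hf hg hmin
  have hle := hmin _ hf₀ _ hf₀
  obtain ⟨H, x₀, y₀, hfx, hgy⟩ := exists_eq_unif_of_rdist_eq_zero h2 hf hg h0
  obtain ⟨x, hx⟩ : ∃ x, 2 * rdist (unif A) (unif {z | z - x ∈ H}) ≤
      17 * rdist (unif A) (unif A) := by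
    rcases le_total (rdist (unif A) f) (rdist (unif A) g) with h | h
    · exact ⟨x₀, by rw [← hfx]; linarith⟩
    · exact ⟨y₀, by rw [← hgy]; linarith⟩
  have hB : ({z | z - x ∈ H} : Finset G).Nonempty := ⟨x, by simp [H.zero_mem]⟩
  have hBH : #({z | z - x ∈ H} : Finset G) = Nat.card H := by
    rw [Nat.card_eq_fintype_card, Fintype.card_subtype]
    exact card_equiv (Equiv.subRight x) (by simp)
  obtain ⟨s, hs⟩ := exists_le_card_filter h2 hA hB
  rw [hBH] at hs
  simp only [mem_filter, mem_univ, true_and] at hs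
  have hNeq : ({a ∈ A | s + a - x ∈ H} : Finset G) = {a ∈ A | a + (s - x) ∈ H} := by
    congr 1; funext a; congr 1; abel
  rw [hNeq] at hs
  refine ⟨H, s - x, ?_⟩
  set N := #{a ∈ A | a + (s - x) ∈ H}
  have hNA : (N : ℝ) ≤ #A := by exact_mod_cast card_filter_le _ _
  have hNH : (N : ℝ) ≤ Nat.card H := by
    rw [← hBH]
    have : N ≤ #({z | z - x ∈ H} : Finset G) :=
      card_le_card_of_injOn (fun a => s + a)
        (fun a ha => by
          have : s + a - x = a + (s - x) := by abel
          simpa [this] using (mem_filter.1 ha).2)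
        (fun a _ b _ h => by simpa using h)
    exact_mod_cast this
  have hA' : (0 : ℝ) < #A := by exact_mod_cast hA.card_pos
  have hH' : (0 : ℝ) < Nat.card H := by exact_mod_cast Nat.card_pos
  have hs' : exp (-(17 * rdist (unif A) (unif A))) * (#A * Nat.card H) ≤ (N : ℝ) ^ 2 :=
    le_trans (mul_le_mul_of_nonneg_right (exp_le_exp.2 (neg_le_neg hx)) (by positivity)) hs
  have hN : (0 : ℝ) ≤ N := Nat.cast_nonneg _
  constructor
  · refine le_of_mul_le_mul_right ?_ hH'
    nlinarith
  · refine le_of_mul_le_mul_right ?_ hA'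
    nlinarith

end Structure

/-! ### Passing to a popular translate -/

section Popular

open Real Finset

variable {Ω G : Type*} [Fintype Ω] [AddCommGroup G] [Fintype G]

lemma ent_le_log_card {α : Type*} [Fintype α] {p : Ω → ℝ} (hp : p ∈ stdSimplex ℝ Ω) (X : Ω → α)
    {s : Finset α} (hs : ∀ ω, p ω ≠ 0 → X ω ∈ s) : ent p X ≤ log #s := by
  have hm := law_mem hp X
  have hzero : ∀ a ∉ s, law p X a = 0 := fun a ha => sum_eq_zero fun ω _ => by
    by_cases h : p ω = 0
    · simp [h]
    · rw [if_neg]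
      rintro rfl
      exact ha (hs ω h)
  have hsum : ∑ a ∈ s, law p X a = 1 := by
    rw [← hm.2]
    exact sum_subset (subset_univ s) fun a _ ha => hzero a ha
  have hne : s.Nonempty := nonempty_of_sum_ne_zero (hsum ▸ one_ne_zero : ∑ a ∈ s, law p X a ≠ 0)
  have hn : (0 : ℝ) < #s := by exact_mod_cast hne.card_pos
  have hent : ent p X = ∑ a ∈ s, negMulLog (law p X a) := by
    rw [ent_eq_sum_negMulLog]
    exact (sum_subset (subset_univ s) fun a _ ha => by rw [hzero a ha, negMulLog_zero]).symm
  have key : ∀ a ∈ s, negMulLog (law p X a) ≤ law p X a * log #s + ((#s : ℝ)⁻¹ - law p X a) := by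
    intro a _
    rcases (hm.1 a).eq_or_lt with h | h
    · rw [← h]; simp
    · have := mul_le_mul_of_nonneg_left (log_le_sub_one_of_pos
        (show 0 < (#s : ℝ)⁻¹ / law p X a by positivity)) h.le
      rw [log_div (by positivity) h.ne', log_inv, mul_sub, mul_sub, mul_div_cancel₀ _ h.ne'] at this
      rw [negMulLog]
      linarith
  have := sum_le_sum key
  rw [← hent, sum_add_distrib, sum_sub_distrib, ← sum_mul, hsum, sum_const, nsmul_eq_mul,
    mul_inv_cancel₀ hn.ne'] at this
  linarith

/-- The entropic Balog–Szemerédi–Gowers lemma without conditioning. -/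
lemma sum_rdist_condw_add_le (h2 : ∀ x : G, x + x = 0) {p : Ω → ℝ} (hp : p ∈ stdSimplex ℝ Ω)
    (A B : Ω → G) :
    ∑ z, law p (fun ω => A ω + B ω) z *
        rdist (law (condw p (fun ω => A ω + B ω) z) A) (law (condw p (fun ω => A ω + B ω) z) B) ≤
      2 * (ent p A + ent p B) - 3 * ent p (fun ω => (A ω, B ω))
        + 2 * ent p (fun ω => A ω + B ω) := by
  have := sum_rdist_condw_le h2 hp A B (fun _ => ())
  have hlaw : ∀ z u, law p (fun ω => (A ω + B ω, ())) (z, u) = law p (fun ω => A ω + B ω) z :=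
    fun z u => by simp [law]
  have hcond : ∀ z u, condw p (fun ω => (A ω + B ω, ())) (z, u) =
      condw p (fun ω => A ω + B ω) z := fun z u => by
    funext ω
    simp [condw, hlaw]
  rw [ent_const hp, ent_congr p (X := fun ω => (A ω, ())) (Y := A) (by simp),
    ent_congr p (X := fun ω => (B ω, ())) (Y := B) (by simp),
    ent_congr p (X := fun ω => (A ω + B ω, ())) (Y := fun ω => A ω + B ω) (by simp),
    ent_congr p (X := fun ω => (A ω, B ω, ())) (Y := fun ω => (A ω, B ω)) (by simp),
    Fintype.sum_prod_type] at this
  simp only [univ_unique, sum_singleton, hlaw, hcond] at this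
  linarith

lemma law_pair_add (p : G × G → ℝ) (x z : G) :
    law p (fun ω => (ω.1, ω.1 + ω.2)) (x, z) = p (x, z - x) := by
  rw [law, sum_eq_single (x, z - x)]
  · simp
  · rintro ⟨a, b⟩ _ h
    refine if_neg fun h' => h ?_
    simp only [Prod.mk.injEq] at h' ⊢
    grind
  · simp

lemma law_snd_pair_add (p : G × G → ℝ) (x z : G) :
    law p (fun ω => (ω.2, ω.1 + ω.2)) (x, z) = p (z - x, x) := by
  rw [law, sum_eq_single (z - x, x)]
  · simp
  · rintro ⟨a, b⟩ _ h
    refine if_neg fun h' => h ?_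
    simp only [Prod.mk.injEq] at h' ⊢
    grind
  · simp

theorem exists_le_exp_mul_card (h2 : ∀ x : G, x + x = 0) {V : Finset G} (hV : V.Nonempty) {δ : ℝ}
    (hE : (#V : ℝ) ^ (3 - 2 * δ) ≤ ∑ z, (#{a ∈ V | z + a ∈ V} : ℝ) ^ 2) :
    ∃ z, ({a ∈ V | z + a ∈ V} : Finset G).Nonempty ∧
      (#V : ℝ) ^ (1 - 70 * δ) ≤
        exp (-(17 * rdist (unif {a ∈ V | z + a ∈ V}) (unif {a ∈ V | z + a ∈ V}))) *
          #{a ∈ V | z + a ∈ V} := by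
  have hn : (0 : ℝ) < #V := by exact_mod_cast hV.card_pos
  set r : G → ℝ := fun z => (#{a ∈ V | z + a ∈ V} : ℝ) with hr
  have hr0 : ∀ z, 0 ≤ r z := fun z => Nat.cast_nonneg _
  set E : ℝ := ∑ z, r z ^ 2 with hEd
  have hEpos : 0 < E := (rpow_pos_of_pos hn _).trans_le hE
  have hsub : ∀ x y : G, x - y = x + y := fun x y => by have := h2 y; grind
  set p : G × G → ℝ := fun ω => if ω.1 ∈ V ∧ ω.2 ∈ V then r (ω.1 + ω.2) / E else 0 with hpd
  have hZ1 : ∀ x z, law p (fun ω => (ω.1, ω.1 + ω.2)) (x, z) =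
      if x ∈ ({a ∈ V | z + a ∈ V} : Finset G) then r z / E else 0 := fun x z => by
    have : x + (z + x) = z := by rw [← hsub z x, add_sub_cancel]
    rw [law_pair_add, hpd]
    simp only [this, hsub z x, mem_filter]
  have hZ2 : ∀ x z, law p (fun ω => (ω.2, ω.1 + ω.2)) (x, z) =
      if x ∈ ({a ∈ V | z + a ∈ V} : Finset G) then r z / E else 0 := fun x z => by
    have : z + x + x = z := by rw [← hsub z x, sub_add_cancel]
    rw [law_snd_pair_add, hpd]
    simp only [this, hsub z x, mem_filter, and_comm]
  have hlaw : ∀ z, law p (fun ω => ω.1 + ω.2) z = r z ^ 2 / E := fun z => by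
    have h := law_law p (fun ω => (ω.1, ω.1 + ω.2)) (fun y => y.2)
    rw [← h, law, Fintype.sum_prod_type]
    simp only [hZ1]
    rw [sum_congr rfl fun x _ => Fintype.sum_eq_single z fun y hy => if_neg hy]
    simp only [if_true, sum_ite_mem, univ_inter, sum_const, nsmul_eq_mul]
    change r z * _ = _
    ring
  have hp : p ∈ stdSimplex ℝ (G × G) := by
    refine ⟨fun ω => ?_, ?_⟩
    · simp only [hpd]
      split_ifs
      · exact div_nonneg (hr0 _) hEpos.le
      · exact le_rfl
    · rw [← sum_law p fun ω => ω.1 + ω.2]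
      simp only [hlaw, ← sum_div]
      exact div_self hEpos.ne'
  have hcond1 : ∀ z, r z ≠ 0 → law (condw p (fun ω => ω.1 + ω.2) z) (fun ω => ω.1) =
      unif {a ∈ V | z + a ∈ V} := fun z hz => by
    funext x
    rw [law_condw, hZ1, hlaw, unif]
    change _ = if _ then (r z)⁻¹ else 0
    split_ifs
    · field_simp
    · simp
  have hcond2 : ∀ z, r z ≠ 0 → law (condw p (fun ω => ω.1 + ω.2) z) (fun ω => ω.2) =
      unif {a ∈ V | z + a ∈ V} := fun z hz => by
    funext x
    rw [law_condw, hZ2, hlaw, unif]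
    change _ = if _ then (r z)⁻¹ else 0
    split_ifs
    · field_simp
    · simp
  have hZm := law_mem hp (fun ω => ω.1 + ω.2)
  set m := law p (fun ω => ω.1 + ω.2) with hm
  have hm0 : ∀ z, m z ≠ 0 → r z ≠ 0 := fun z hz h => hz (by rw [hlaw, h]; simp)
  have hJ : ent p (fun ω => (ω.1, ω.2)) = log E - ∑ z, m z * log (r z) := by
    rw [sum_law_mul p (fun ω => ω.1 + ω.2) fun z => log (r z), ← mul_one (log E), ← hp.2, mul_sum,
      ← sum_sub_distrib, ent, ← sum_neg_distrib]
    refine sum_congr rfl fun ω _ => ?_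
    rw [law_id p]
    by_cases h : p ω = 0
    · simp [h]
    · have h' : p ω = r (ω.1 + ω.2) / E := by
        simp only [hpd] at h ⊢
        exact if_pos (by by_contra h'; exact h (if_neg h'))
      have hr' : r (ω.1 + ω.2) ≠ 0 := fun h0 => h (by rw [h', h0, zero_div])
      change -(p ω * log (p ω)) = _
      rw [show log (p ω) = log (r (ω.1 + ω.2)) - log E by rw [h', log_div hr' hEpos.ne']]
      ring
  have hZ : ent p (fun ω => ω.1 + ω.2) = log E - 2 * ∑ z, m z * log (r z) := by
    rw [ent_eq_sum_negMulLog, ← mul_one (log E), ← hZm.2, mul_sum, mul_sum, ← sum_sub_distrib]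
    refine sum_congr rfl fun z _ => ?_
    by_cases h : m z = 0
    · rw [← hm, h]; simp
    · rw [← hm, negMulLog,
        show log (m z) = 2 * log (r z) - log E by
          rw [hlaw, log_div (pow_ne_zero 2 (hm0 z h)) hEpos.ne', log_pow]; push_cast; ring]
      ring
  have hmemV : ∀ ω, p ω ≠ 0 → ω.1 ∈ V ∧ ω.2 ∈ V := fun ω hω => by
    by_contra h
    exact hω (if_neg h)
  have hA := ent_le_log_card hp (fun ω => ω.1) fun ω hω => (hmemV ω hω).1
  have hB := ent_le_log_card hp (fun ω => ω.2) fun ω hω => (hmemV ω hω).2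
  have hAB := ent_pair_le hp (J := fun ω => (ω.1, ω.2)) (A := fun ω => ω.1) (B := fun ω => ω.2)
    (by simp only [Prod.mk.injEq]; tauto)
  have hbsg := sum_rdist_condw_add_le h2 hp (fun ω => ω.1) (fun ω => ω.2)
  have hlogE : (3 - 2 * δ) * log #V ≤ log E := by
    rw [← log_rpow hn]
    exact log_le_log (rpow_pos_of_pos hn _) hE
  obtain ⟨z, hz, hle⟩ := exists_le_of_sum_mul_le hZm (φ := fun z =>
    17 * rdist (law (condw p (fun ω => ω.1 + ω.2) z) (fun ω => ω.1))
      (law (condw p (fun ω => ω.1 + ω.2) z) (fun ω => ω.2)) - log (r z))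
    (T := -(1 - 70 * δ) * log #V) (by
      simp only [mul_sub, mul_left_comm _ (17 : ℝ), sum_sub_distrib, ← mul_sum]
      rw [hJ] at hAB hbsg
      rw [hZ] at hbsg
      linarith)
  have hrz : 0 < r z := (hr0 z).lt_of_ne' (hm0 z hz)
  refine ⟨z, card_pos.1 (Nat.cast_pos.1 hrz), ?_⟩
  simp only [hcond1 z hrz.ne', hcond2 z hrz.ne'] at hle
  change _ ≤ _ * r z
  rw [← log_le_log_iff (rpow_pos_of_pos hn _) (mul_pos (exp_pos _) hrz), log_rpow hn,
    log_mul (exp_ne_zero _) hrz.ne', log_exp]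
  linarith

end Popular

/-! ### The large intersection with a coset -/

section LargeCoset

open Real Finset

variable {G : Type*} [AddCommGroup G] [Fintype G]

theorem exists_subgroup_of_le_sum_sq (h2 : ∀ x : G, x + x = 0) {V : Finset G} (hV : V.Nonempty)
    {δ : ℝ} (hE : (#V : ℝ) ^ (3 - 2 * δ) ≤ ∑ z, (#{a ∈ V | z + a ∈ V} : ℝ) ^ 2) :
    ∃ (κ : ℝ) (H : AddSubgroup G) (t : G), 0 ≤ κ ∧ (#V : ℝ) ^ (1 - 70 * δ) ≤ κ * #V ∧
      (#V : ℝ) ^ (1 - 70 * δ) ≤ #{a ∈ V | a + t ∈ H} ∧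
      κ * Nat.card H ≤ #{a ∈ V | a + t ∈ H} := by
  obtain ⟨z, hne, hz⟩ := exists_le_exp_mul_card h2 hV hE
  obtain ⟨H, t, h3, h4⟩ := exists_subgroup_card_filter h2 hne
  have hAV : (#{a ∈ V | z + a ∈ V} : ℝ) ≤ #V := by exact_mod_cast card_filter_le _ _
  have hHV : (#{a ∈ ({a ∈ V | z + a ∈ V} : Finset G) | a + t ∈ H} : ℝ) ≤
      #{a ∈ V | a + t ∈ H} := by
    exact_mod_cast card_le_card (filter_subset_filter _ (filter_subset _ _))
  exact ⟨_, H, t, (exp_pos _).le, hz.trans (mul_le_mul_of_nonneg_left hAV (exp_pos _).le),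
    (hz.trans h3).trans hHV, h4.trans hHV⟩

end LargeCoset

/-! ### Subspaces -/

section Subspace

open Finset

variable {d : ℕ}

lemma fin_zmod_two_add_self (x : Fin d → ZMod 2) : x + x = 0 := by
  funext i
  exact CharTwo.add_self_eq_zero (x i)

lemma energy4_eq_sum (V : Finset (Fin d → ZMod 2)) :
    energy4 V = ∑ z, #{a ∈ V | z + a ∈ V} ^ 2 := by
  have h2 := @fin_zmod_two_add_self d
  simp only [sq, ← card_product]
  rw [← card_sigma, energy4]
  refine card_nbij' (fun q => ⟨q.1 + q.2.1, (q.1, q.2.2.1)⟩)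
    (fun s => (s.2.1, s.1 + s.2.1, s.2.2, s.1 + s.2.2)) ?_ ?_ ?_ ?_
  · rintro ⟨a, b, c, e⟩ h
    simp only [coe_filter, mem_product, Set.mem_ofPred_eq, coe_sigma, Set.mem_sigma_iff, coe_univ,
      Set.mem_univ, mem_coe, mem_filter, true_and] at h ⊢
    obtain ⟨⟨ha, hb, hc, he⟩, h⟩ := h
    have e1 : a + b + a = b := by have := h2 a; grind
    have e2 : a + b + c = e := by have := h2 e; grind
    rw [e1, e2]
    exact ⟨⟨ha, hb⟩, hc, he⟩
  · rintro ⟨z, a, c⟩ h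
    simp only [coe_filter, mem_product, Set.mem_ofPred_eq, coe_sigma, Set.mem_sigma_iff, coe_univ,
      Set.mem_univ, mem_coe, mem_filter, true_and] at h ⊢
    obtain ⟨⟨ha, hb⟩, hc, he⟩ := h
    exact ⟨⟨ha, hb, hc, he⟩, by have := h2 a; have := h2 z; have := h2 c; grind⟩
  · rintro ⟨a, b, c, e⟩ h
    simp only [coe_filter, mem_product, Set.mem_ofPred_eq] at h
    have e1 : a + b + a = b := by have := h2 a; grind
    have e2 : a + b + c = e := by have := h2 e; grind
    simp only [e1, e2]
  · rintro ⟨z, a, c⟩ _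
    have e1 : a + (z + a) = z := by have := h2 a; grind
    simp only [e1]

/-- A coset of a subspace is contained in a subspace of at most twice the size. -/
lemma exists_submodule_of_coset (H : Submodule (ZMod 2) (Fin d → ZMod 2)) (t : Fin d → ZMod 2) :
    ∃ H' : Submodule (ZMod 2) (Fin d → ZMod 2), Nat.card H' ≤ 2 * Nat.card H ∧
      ∀ a, a + t ∈ H → a ∈ H' := by
  have h2 := @fin_zmod_two_add_self d
  refine ⟨H ⊔ Submodule.span (ZMod 2) {t}, ?_, fun a ha => ?_⟩
  · have hsurj : Function.Surjective fun x : ZMod 2 × H =>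
        (⟨x.2 + x.1 • t, Submodule.add_mem_sup x.2.2
          (Submodule.smul_mem _ _ (Submodule.mem_span_singleton_self t))⟩ :
          (H ⊔ Submodule.span (ZMod 2) {t} : Submodule _ _)) := by
      rintro ⟨x, hx⟩
      obtain ⟨y, hy, z, hz, rfl⟩ := Submodule.mem_sup.1 hx
      obtain ⟨c, rfl⟩ := Submodule.mem_span_singleton.1 hz
      exact ⟨(c, ⟨y, hy⟩), rfl⟩
    have := Nat.card_le_card_of_surjective _ hsurj
    rwa [Nat.card_prod, Nat.card_zmod] at this
  · have : a = a + t + t := by rw [add_assoc, h2, add_zero]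
    rw [this]
    exact Submodule.add_mem_sup ha (Submodule.mem_span_singleton_self t)

/-- Averaging over the cosets of a subspace inside a coset of a larger subspace. -/
lemma exists_card_filter_mul_le (V : Finset (Fin d → ZMod 2))
    {H₁ H : Submodule (ZMod 2) (Fin d → ZMod 2)} (hle : H₁ ≤ H) (t : Fin d → ZMod 2) :
    ∃ t', #{a ∈ V | a + t ∈ H} * Nat.card H₁ ≤ #{a ∈ V | a + t' ∈ H₁} * Nat.card H := by
  have hcard : ∀ K : Submodule (ZMod 2) (Fin d → ZMod 2), #{x | x ∈ K} = Nat.card K := fun K => by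
    rw [Nat.card_eq_fintype_card, Fintype.card_subtype]
  by_contra! hcon
  have h1 : ∑ h with h ∈ H, #{a ∈ V | a + (t + h) ∈ H₁} = #{a ∈ V | a + t ∈ H} * Nat.card H₁ := by
    have := sum_card_bipartiteAbove_eq_sum_card_bipartiteBelow (s := {h | h ∈ H}) (t := V)
      (fun h a => a + (t + h) ∈ H₁)
    simp only [bipartiteAbove, bipartiteBelow] at this
    rw [this, card_filter, sum_mul]
    refine sum_congr rfl fun a _ => ?_
    split_ifs with ha
    · rw [one_mul, ← hcard, filter_filter]
      refine card_equiv (Equiv.addLeft (a + t)) fun h => ?_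
      simp only [mem_filter, mem_univ, true_and, Equiv.coe_addLeft, add_assoc]
      refine ⟨fun h => h.2, fun h' => ⟨?_, h'⟩⟩
      have := H.sub_mem (hle h') ha
      rwa [← add_assoc, add_sub_cancel_left] at this
    · rw [zero_mul, card_eq_zero, filter_eq_empty_iff]
      intro h hh h'
      refine ha ?_
      have := H.sub_mem (hle h') (mem_filter.1 hh).2
      rwa [← add_assoc, add_sub_cancel_right] at this
  have h2 : ∑ h with h ∈ H, #{a ∈ V | a + (t + h) ∈ H₁} * Nat.card H <
      ∑ h ∈ ({h | h ∈ H} : Finset (Fin d → ZMod 2)), #{a ∈ V | a + t ∈ H} * Nat.card H₁ :=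
    sum_lt_sum_of_nonempty ⟨0, by simp⟩ fun h _ => hcon (t + h)
  rw [← sum_mul, h1, sum_const, hcard, smul_eq_mul, mul_comm] at h2
  exact lt_irrefl _ h2

lemma exists_submodule_card_le {V : Finset (Fin d → ZMod 2)} {n : ℕ} (hn : 1 ≤ n)
    (H : Submodule (ZMod 2) (Fin d → ZMod 2)) (t : Fin d → ZMod 2) {κ : ℝ} (hκ : 0 ≤ κ)
    (hH : κ * Nat.card H ≤ #{a ∈ V | a + t ∈ H}) :
    ∃ H' : Submodule (ZMod 2) (Fin d → ZMod 2), Nat.card H' ≤ 2 * n ∧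
      (κ * n / 2 ≤ #{a ∈ V | a ∈ H'} ∨ (#{a ∈ V | a + t ∈ H} : ℝ) ≤ #{a ∈ V | a ∈ H'}) := by
  rcases le_total (Nat.card H) n with hc | hc
  · obtain ⟨H', h1, h2⟩ := exists_submodule_of_coset H t
    refine ⟨H', h1.trans (by omega), Or.inr ?_⟩
    exact_mod_cast card_le_card (monotone_filter_right V fun a _ h => h2 a h)
  · obtain ⟨H₁, hH₁n, hnH₁, hle⟩ :=
      ZModModule.exists_submodule_subset_card_le Nat.prime_two H hc (by omega)
    obtain ⟨t', ht'⟩ := exists_card_filter_mul_le V hle t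
    obtain ⟨H', h1, h2⟩ := exists_submodule_of_coset H₁ t'
    refine ⟨H', h1.trans (by omega), Or.inl ?_⟩
    have h3 : (#{a ∈ V | a + t' ∈ H₁} : ℝ) ≤ #{a ∈ V | a ∈ H'} := by
      exact_mod_cast card_le_card (monotone_filter_right V fun a _ h => h2 a h)
    have hH0 : (0 : ℝ) < Nat.card H := by exact_mod_cast Nat.card_pos
    have h4 : (#{a ∈ V | a + t ∈ H} : ℝ) * Nat.card H₁ ≤ #{a ∈ V | a + t' ∈ H₁} * Nat.card H := by
      exact_mod_cast ht'
    have h5 : κ * Nat.card H₁ ≤ #{a ∈ V | a + t' ∈ H₁} := by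
      refine le_of_mul_le_mul_right (le_trans ?_ h4) hH0
      rw [mul_right_comm]
      exact mul_le_mul_of_nonneg_right hH (Nat.cast_nonneg _)
    have h6 : (n : ℝ) ≤ 2 * Nat.card H₁ := by exact_mod_cast hnH₁.le
    nlinarith

end Subspace

/-- (BSG + PFR combination) There is `c > 0` such that, with `ε = 0.0028`,
for all `n ≥ 1`, `d`, and every `V ⊆ 𝔽₂^d` with `|V| = n` and `E₄(V) ≥ n ^ (3 - 2ε)`,
there is a subspace `H ≤ 𝔽₂^d` with `|H| ≤ 2n` and `|V ∩ H| ≥ c * n ^ (1 - 73ε)`. -/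
theorem statement12 :
    ∃ c : ℝ, 0 < c ∧
      ∀ (n d : ℕ), 1 ≤ n →
        ∀ V : Finset (Fin d → ZMod 2), V.card = n →
          (n : ℝ) ^ ((3 : ℝ) - 2 * 0.0028) ≤ (energy4 V : ℝ) →
          ∃ H : Submodule (ZMod 2) (Fin d → ZMod 2),
            Nat.card H ≤ 2 * n ∧
            c * (n : ℝ) ^ ((1 : ℝ) - 73 * 0.0028) ≤ ((V.filter (fun w => w ∈ H)).card : ℝ) := by
  refine ⟨1 / 2, by norm_num, fun n d hn V hV hE => ?_⟩
  subst hV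
  rw [energy4_eq_sum] at hE
  push_cast at hE
  obtain ⟨κ, K, t, hκ, h1, h2, h3⟩ := exists_subgroup_of_le_sum_sq (δ := 0.0028)
    fin_zmod_two_add_self (Finset.card_pos.1 hn) (by convert hE; rfl)
  obtain ⟨H, hH, h⟩ := exists_submodule_card_le hn (AddSubgroup.toZModSubmodule 2 K) t hκ h3
  have hpow : (V.card : ℝ) ^ ((1 : ℝ) - 73 * 0.0028) ≤ (V.card : ℝ) ^ ((1 : ℝ) - 70 * 0.0028) :=
    Real.rpow_le_rpow_of_exponent_le (by exact_mod_cast hn) (by norm_num)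
  have hpos : 0 ≤ (V.card : ℝ) ^ ((1 : ℝ) - 73 * 0.0028) := by positivity
  refine ⟨H, hH, ?_⟩
  rcases h with h | h
  · linarith
  · have := h2.trans h
    linarith
end
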